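/- arXiv:1809.03220 — 3 statements merged into one kernel-verified Lean document; each statement's English description precedes it below -/
import Mathlib

section
/- Let Σ be a nonempty finite alphabet. An ω-language L ⊆ Σ^ω is accepted by a nondeterministic Büchi automaton with finite state set if and only if it is accepted by a deterministic Muller automaton with finite state set (McNaughton's theorem); moreover these conditions are also equivalent to L being accepted by a nondeterministic Muller automaton with finite state set. -/
/-- The ω-language accepted by the nondeterministic Büchi automaton `(K, δ, q₀, F)`:
`x` is accepted iff some run on `x` visits `F` infinitely often. -/
def nbaLang {α K : Type*} (δ : K → α → Set K) (q₀ : K) (F : Set K) : Set (ℕ → α) :=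
  {x | ∃ r : ℕ → K, r 0 = q₀ ∧ (∀ n, r (n + 1) ∈ δ (r n) (x n)) ∧
    {n : ℕ | r n ∈ F}.Infinite}

/-- The ω-language accepted by the nondeterministic Muller automaton `(K, δ, q₀, 𝓕)`:
`x` is accepted iff some run on `x` has its set of infinitely-visited states in `𝓕`. -/
def nmaLang {α K : Type*} (δ : K → α → Set K) (q₀ : K) (𝓕 : Set (Set K)) :
    Set (ℕ → α) :=
  {x | ∃ r : ℕ → K, r 0 = q₀ ∧ (∀ n, r (n + 1) ∈ δ (r n) (x n)) ∧
    {q : K | {n : ℕ | r n = q}.Infinite} ∈ 𝓕}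

/-- The unique run of a deterministic automaton `(δ, q₀)` on the ω-word `x`. -/
def detRun {K α : Type*} (δ : K → α → K) (q₀ : K) (x : ℕ → α) : ℕ → K :=
  fun n => Nat.rec (motive := fun _ => K) q₀ (fun i q => δ q (x i)) n

/-- The ω-language accepted by the deterministic Muller automaton `(K, δ, q₀, 𝓕)`. -/
def dmaLang {α K : Type*} (δ : K → α → K) (q₀ : K) (𝓕 : Set (Set K)) : Set (ℕ → α) :=
  {x | {q : K | {n : ℕ | detRun δ q₀ x n = q}.Infinite} ∈ 𝓕}

open Filter

namespace McN

/-- Profiles of finite words: `r p b q` holds iff there is a path from `p` to `q`,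
with `b` recording whether an accepting state is entered. -/
def Prof (K : Type) : Type := K → Bool → K → Prop

noncomputable instance (K : Type) : Monoid (Prof K) where
  mul r s := fun p b q => ∃ t c d, r p c t ∧ s t d q ∧ b = (c || d)
  one := fun p b q => p = q ∧ b = false
  mul_assoc r s t := by
    funext p b q
    apply propext
    constructor
    · rintro ⟨u, c, d, ⟨v, c', d', h1, h2, rfl⟩, h3, rfl⟩
      exact ⟨v, c', d' || d, h1, ⟨u, d', d, h2, h3, rfl⟩, by simp [Bool.or_assoc]⟩
    · rintro ⟨u, c, d, h1, ⟨v, c', d', h2, h3, rfl⟩, rfl⟩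
      exact ⟨v, c || c', d', ⟨u, c, c', h1, h2, rfl⟩, h3, by simp [Bool.or_assoc]⟩
  one_mul r := by
    funext p b q
    apply propext
    constructor
    · rintro ⟨u, c, d, ⟨rfl, rfl⟩, h3, rfl⟩
      simpa using h3
    · intro h
      exact ⟨p, false, b, ⟨rfl, rfl⟩, h, by simp⟩
  mul_one r := by
    funext p b q
    apply propext
    constructor
    · rintro ⟨u, c, d, h3, ⟨rfl, rfl⟩, rfl⟩
      simpa using h3
    · intro h
      exact ⟨q, b, false, h, ⟨rfl, rfl⟩, by simp⟩

instance (K : Type) [Finite K] : Finite (Prof K) := by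
  unfold Prof; infer_instance

theorem Prof.mul_iff {K : Type} (r s : Prof K) (p b q) :
    (r * s) p b q ↔ ∃ t c d, r p c t ∧ s t d q ∧ b = (c || d) := Iff.rfl

theorem Prof.one_iff {K : Type} (p b q) :
    (1 : Prof K) p b q ↔ p = q ∧ b = false := Iff.rfl

/-- product of a segment -/
def pr {M : Type} [Monoid M] (z : ℕ → M) (i j : ℕ) : M := ((List.Ico i j).map z).prod

section pr
variable {M : Type} [Monoid M] (z : ℕ → M)

theorem pr_self (i : ℕ) : pr z i i = 1 := by simp [pr]

theorem pr_mul {i j k : ℕ} (h : i ≤ j) (h' : j ≤ k) : pr z i j * pr z j k = pr z i k := by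
  simp only [pr, ← List.prod_append, ← List.map_append, List.Ico.append_consecutive h h']

theorem pr_one (i : ℕ) : pr z i (i+1) = z i := by simp [pr, List.Ico.succ_singleton]

theorem pr_succ {i j : ℕ} (h : i ≤ j) : pr z i (j+1) = pr z i j * z j := by
  rw [← pr_mul z h (Nat.le_succ j), pr_one]

end pr

theorem path_iff {K : Type} (z : ℕ → Prof K) (i n : ℕ) (p : K) (b : Bool) (q : K) :
    pr z i (i + n) p b q ↔ ∃ (ρ : ℕ → K) (β : ℕ → Bool), ρ i = p ∧ ρ (i + n) = q ∧
      (∀ k, i ≤ k → k < i + n → z k (ρ k) (β k) (ρ (k+1))) ∧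
      (b = true ↔ ∃ k, i ≤ k ∧ k < i + n ∧ β k = true) := by
  induction n generalizing b q with
  | zero =>
    simp only [Nat.add_zero, pr_self, Prof.one_iff]
    constructor
    · rintro ⟨rfl, rfl⟩
      refine ⟨fun _ => p, fun _ => false, rfl, rfl, fun k h1 h2 => by omega, by simp⟩
    · rintro ⟨ρ, β, rfl, rfl, -, h⟩
      refine ⟨rfl, ?_⟩
      rw [← Bool.not_eq_true, h]
      rintro ⟨k, h1, h2, -⟩
      omega
  | succ n ih =>
    rw [← Nat.add_assoc, pr_succ z (by omega), Prof.mul_iff]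
    constructor
    · rintro ⟨t, c, d, h1, h2, rfl⟩
      obtain ⟨ρ, β, r1, r2, r3, r4⟩ := (ih c t).1 h1
      refine ⟨fun k => if k ≤ i + n then ρ k else q, fun k => if k < i + n then β k else d,
        by simp [r1], by simp, ?_, ?_⟩
      · intro k hk hk'
        by_cases hkn : k < i + n
        · have a1 : k ≤ i + n := by omega
          have a2 : k + 1 ≤ i + n := by omega
          simp only [a1, a2, hkn, if_true]
          exact r3 k hk hkn
        · obtain rfl : k = i + n := by omega
          simp only [le_refl, lt_irrefl, if_true, if_false]
          rw [if_neg (by omega), r2]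
          exact h2
      · rw [Bool.or_eq_true, r4]
        constructor
        · rintro (⟨k, a1, a2, a3⟩ | h)
          · exact ⟨k, a1, by omega, by simp [a2, a3]⟩
          · exact ⟨i + n, by omega, by omega, by simp [h]⟩
        · rintro ⟨k, a1, a2, a3⟩
          by_cases hkn : k < i + n
          · left; exact ⟨k, a1, hkn, by simpa [hkn] using a3⟩
          · right; simpa [hkn] using a3
    · rintro ⟨ρ, β, r1, r2, r3, r4⟩
      classical
      refine ⟨ρ (i+n), decide (∃ k, i ≤ k ∧ k < i + n ∧ β k = true), β (i+n), ?_, ?_, ?_⟩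
      · rw [ih]
        exact ⟨ρ, β, r1, rfl, fun k h1 h2 => r3 k h1 (by omega), by simp⟩
      · rw [← r2]
        exact r3 _ (by omega) (by omega)
      · rw [Bool.eq_iff_iff, r4, Bool.or_eq_true, decide_eq_true_iff]
        constructor
        · rintro ⟨k, a1, a2, a3⟩
          by_cases hkn : k < i + n
          · left; exact ⟨k, a1, hkn, a3⟩
          · right
            obtain rfl : k = i + n := by omega
            exact a3
        · rintro (⟨k, a1, a2, a3⟩ | h)
          · exact ⟨k, a1, by omega, a3⟩
          · exact ⟨i + n, by omega, by omega, h⟩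

/-- acceptance of a sequence of profiles -/
def Acc {K : Type} (q₀ : K) (z : ℕ → Prof K) : Prop :=
  ∃ (q : ℕ → K) (b : ℕ → Bool), q 0 = q₀ ∧ (∀ n, z n (q n) (b n) (q (n+1))) ∧
    ∀ N, ∃ n, N ≤ n ∧ b n = true

theorem exists_idx (h : ℕ → ℕ) (hm : StrictMono h) (h0 : h 0 = 0) (k : ℕ) :
    ∃ n, h n ≤ k ∧ k < h (n+1) := by
  have hex : ∃ n, k < h (n+1) := ⟨k, lt_of_lt_of_le (Nat.lt_succ_self k) (hm.id_le (k+1))⟩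
  classical
  refine ⟨Nat.find hex, ?_, Nat.find_spec hex⟩
  rcases Nat.eq_zero_or_pos (Nat.find hex) with h' | h'
  · rw [h', h0]; omega
  · have := Nat.find_min hex (m := Nat.find hex - 1) (by omega)
    rw [Nat.sub_add_cancel h'] at this
    omega

theorem idx_unique (h : ℕ → ℕ) (hm : StrictMono h) {k n m : ℕ}
    (h1 : h n ≤ k) (h2 : k < h (n+1)) (h3 : h m ≤ k) (h4 : k < h (m+1)) : n = m := by
  have a := hm.lt_iff_lt.1 (lt_of_le_of_lt h1 h4)
  have b := hm.lt_iff_lt.1 (lt_of_le_of_lt h3 h2)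
  omega

theorem acc_group {K : Type} (q₀ : K) (z : ℕ → Prof K) (h : ℕ → ℕ) (hm : StrictMono h)
    (h0 : h 0 = 0) : Acc q₀ z ↔ Acc q₀ (fun n => pr z (h n) (h (n+1))) := by
  have path : ∀ n p b q, pr z (h n) (h (n+1)) p b q ↔
      ∃ (ρ : ℕ → K) (β : ℕ → Bool), ρ (h n) = p ∧ ρ (h (n+1)) = q ∧
      (∀ k, h n ≤ k → k < h (n+1) → z k (ρ k) (β k) (ρ (k+1))) ∧
      (b = true ↔ ∃ k, h n ≤ k ∧ k < h (n+1) ∧ β k = true) := by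
    intro n p b q
    have := path_iff z (h n) (h (n+1) - h n) p b q
    rwa [Nat.add_sub_cancel' (hm (Nat.lt_succ_self n)).le] at this
  constructor
  · rintro ⟨q, b, hq, ht, hb⟩
    classical
    refine ⟨fun n => q (h n), fun n => decide (∃ k, h n ≤ k ∧ k < h (n+1) ∧ b k = true),
      by simp [h0, hq], ?_, ?_⟩
    · intro n
      exact (path _ _ _ _).2 ⟨q, b, rfl, rfl, fun k _ _ => ht k, by simp⟩
    · intro N
      obtain ⟨k, hk, hbk⟩ := hb (h N)
      obtain ⟨n, hn1, hn2⟩ := exists_idx h hm h0 k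
      refine ⟨n, ?_, by simpa using ⟨k, hn1, hn2, hbk⟩⟩
      have := hm.lt_iff_lt.1 (lt_of_le_of_lt hk hn2)
      omega
  · rintro ⟨q, b, hq, ht, hb⟩
    choose ρ β r1 r2 r3 r4 using fun n => (path _ _ _ _).1 (ht n)
    choose ix i1 i2 using exists_idx h hm h0
    have ixe : ∀ k n, h n ≤ k → k < h (n+1) → ix k = n := fun k n a b =>
      idx_unique h hm (i1 k) (i2 k) a b
    refine ⟨fun k => ρ (ix k) k, fun k => β (ix k) k, ?_, ?_, ?_⟩
    · have : ix 0 = 0 := ixe 0 0 (by omega) (by have := hm (show 0 < 0 + 1 by omega); omega)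
      show ρ (ix 0) 0 = q₀
      rw [this, ← hq]
      have := r1 0
      rwa [h0] at this
    · intro k
      have key := r3 (ix k) k (i1 k) (i2 k)
      have : ρ (ix (k+1)) (k+1) = ρ (ix k) (k+1) := by
        by_cases hk : k + 1 < h (ix k + 1)
        · rw [ixe (k+1) (ix k) (by have := i1 k; omega) hk]
        · have hk' : k + 1 = h (ix k + 1) := by have := i2 k; omega
          have : ix (k+1) = ix k + 1 := ixe _ _ hk'.ge (by rw [hk']; exact hm (Nat.lt_succ_self _))
          rw [this]
          conv_lhs => rw [hk', r1]
          rw [hk', r2]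
      show z k (ρ (ix k) k) (β (ix k) k) (ρ (ix (k+1)) (k+1))
      rw [this]
      exact key
    · intro N
      obtain ⟨n, hn, hbn⟩ := hb N
      obtain ⟨k, k1, k2, k3⟩ := (r4 n).1 hbn
      refine ⟨k, le_trans hn (le_trans (hm.id_le n) k1), ?_⟩
      show β (ix k) k = true
      rw [ixe k n k1 k2]; exact k3

/-- additive Ramsey factorisations -/
def TP {M : Type} [Monoid M] (z : ℕ → M) (s e : M) : Prop :=
  ∃ g : ℕ → ℕ, StrictMono g ∧ (∀ n, pr z 0 (g n) = s) ∧ ∀ n m, n < m → pr z (g n) (g m) = e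

section core
variable {M : Type} [Monoid M]

theorem TP.idem {z : ℕ → M} {s e : M} (h : TP z s e) : e * e = e := by
  obtain ⟨g, hg, -, h2⟩ := h
  have := pr_mul z (hg (show 0 < 1 by omega)).le (hg (show 1 < 2 by omega)).le
  rwa [h2 _ _ (by omega), h2 _ _ (by omega), h2 _ _ (by omega)] at this

theorem TP.link {z : ℕ → M} {s e : M} (h : TP z s e) : s * e = s := by
  obtain ⟨g, hg, h1, h2⟩ := h
  have := pr_mul z (Nat.zero_le _) (hg (show 0 < 1 by omega)).le
  rwa [h2 _ _ (by omega), h1, h1] at this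

theorem TP.of_succ {z : ℕ → M} {s e : M} (g : ℕ → ℕ) (hg : StrictMono g)
    (h0 : pr z 0 (g 0) = s) (h : ∀ n, pr z (g n) (g (n+1)) = e) (hse : s * e = s)
    (hee : e * e = e) : TP z s e := by
  have h2 : ∀ n k, pr z (g n) (g (n+k+1)) = e := by
    intro n k
    induction k with
    | zero => exact h n
    | succ k ih =>
      rw [← pr_mul z (hg (show n < n+k+1 by omega)).le (hg (show n+k+1 < n+(k+1)+1 by omega)).le,
        ih]
      refine Eq.trans ?_ hee
      exact congrArg (e * ·) (h _)
  refine ⟨g, hg, ?_, ?_⟩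
  · intro n
    induction n with
    | zero => exact h0
    | succ n ih =>
      rw [← pr_mul z (Nat.zero_le _) (hg (Nat.lt_succ_self n)).le, ih, h, hse]
  · intro n m hnm
    obtain ⟨k, rfl⟩ := Nat.exists_eq_add_of_lt hnm
    exact h2 n k

theorem ramsey {M : Type} [Finite M] (Q : ℕ → Prop) (hQ : {n | Q n}.Infinite) (B : ℕ → ℕ)
    (c : ℕ → ℕ → M) : ∃ (g : ℕ → ℕ) (e : M), StrictMono g ∧ (∀ n, Q (g n)) ∧
      ∀ n m, n < m → B (g n) ≤ g m ∧ c (g n) (g m) = e := by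
  have hne : (atTop ⊓ 𝓟 {n | Q n} : Filter ℕ).NeBot := by
    rw [← Nat.cofinite_eq_atTop]
    exact Filter.cofinite_inf_principal_neBot_iff.2 hQ
  let U : Ultrafilter ℕ := Ultrafilter.of (atTop ⊓ 𝓟 {n | Q n})
  have hU : (U : Filter ℕ) ≤ atTop ⊓ 𝓟 {n | Q n} := Ultrafilter.of_le _
  have hU1 : ∀ N, ∀ᶠ n in (U : Filter ℕ), N ≤ n := fun N =>
    (hU.trans inf_le_left) (eventually_ge_atTop N)
  have hU2 : ∀ᶠ n in (U : Filter ℕ), Q n := (hU.trans inf_le_right) (mem_principal_self _)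
  have pig : ∀ f : ℕ → M, ∃ e, ∀ᶠ n in (U : Filter ℕ), f n = e := by
    intro f
    by_contra hcon
    push Not at hcon
    have : ∀ e, ∀ᶠ n in (U : Filter ℕ), f n ≠ e := fun e =>
      Ultrafilter.eventually_not.2 (by simpa using hcon e)
    obtain ⟨n, hn⟩ := (eventually_all.2 this).exists
    exact hn _ rfl
  choose col hcol using fun i => pig (c i)
  obtain ⟨e, he⟩ := pig col
  obtain ⟨g, g1, g2⟩ := exists_seq_of_forall_finset_exists (fun i => Q i ∧ col i = e)
    (fun i j => i < j ∧ B i ≤ j ∧ c i j = e) (by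
      intro s hs
      have : ∀ᶠ j in (U : Filter ℕ), ∀ i ∈ s, i < j ∧ B i ≤ j ∧ c i j = e := by
        rw [Filter.eventually_all_finset]
        intro i hi
        filter_upwards [hU1 (i+1), hU1 (B i), hcol i] with j a b d
        exact ⟨a, b, d.trans (hs i hi).2⟩
      obtain ⟨j, a, b, d⟩ := (hU2.and (he.and this)).exists
      exact ⟨j, ⟨a, b⟩, d⟩)
  exact ⟨g, e, fun n m h => (g2 n m h).1, fun n => (g1 n).1, fun n m h => (g2 n m h).2⟩

theorem TP.exists [Finite M] (z : ℕ → M) : ∃ s e, TP z s e := by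
  obtain ⟨g, e, g1, -, g2⟩ := ramsey (fun _ => True) (by simpa using Set.infinite_univ)
    (fun _ => 0) (pr z)
  refine ⟨pr z 0 (g 0) * e, e, fun n => g (n+1), fun n m h => g1 (by omega), fun n => ?_,
    fun n m h => (g2 _ _ (by omega)).2⟩
  rw [← (g2 0 (n+1) (by omega)).2, pr_mul z (by omega) (g1 (by omega)).le]

/-- `k` is a first hit -/
def Hit (z : ℕ → M) (s e : M) (k : ℕ) : Prop :=
  ∃ i, i < k ∧ pr z 0 i = s ∧ pr z i k = e ∧ ∀ j, i < j → j < k → pr z i j ≠ e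

theorem TP.hit {z : ℕ → M} {s e : M} (h : TP z s e) : {k | Hit z s e k}.Infinite := by
  obtain ⟨g, hg, h1, h2⟩ := h
  rw [Set.infinite_iff_exists_gt]
  intro n
  classical
  have hex : ∃ k, g n < k ∧ pr z (g n) k = e := ⟨g (n+1), hg (by omega), h2 _ _ (by omega)⟩
  have hs := Nat.find_spec hex
  refine ⟨Nat.find hex, ⟨g n, hs.1, h1 n, hs.2, fun j hj hj' he => ?_⟩,
    lt_of_le_of_lt (hg.id_le n) hs.1⟩
  exact Nat.find_min hex hj' ⟨hj, he⟩

theorem TP.of_hit [Finite M] {z : ℕ → M} {s e : M} (h : {k | Hit z s e k}.Infinite)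
    (hee : e * e = e) : ∃ f, TP z s f ∧ e * f = f := by
  have hinf : {i | ∃ k, i < k ∧ pr z 0 i = s ∧ pr z i k = e}.Infinite := by
    intro hfin
    apply h
    refine (hfin.biUnion (t := fun i => {k | i < k ∧ pr z i k = e ∧
      ∀ j, i < j → j < k → pr z i j ≠ e}) ?_).subset ?_
    · intro i _
      apply Set.Subsingleton.finite
      rintro k ⟨a1, a2, a3⟩ k' ⟨b1, b2, b3⟩
      rcases lt_trichotomy k k' with h | h | h
      · exact absurd a2 (b3 k a1 h)
      · exact h
      · exact absurd b2 (a3 k' b1 h)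
    · rintro k ⟨i, a1, a2, a3, a4⟩
      simp only [Set.mem_iUnion]
      exact ⟨i, ⟨k, a1, a2, a3⟩, a1, a3, a4⟩
  classical
  let B : ℕ → ℕ := fun i => if h : ∃ k, i < k ∧ pr z 0 i = s ∧ pr z i k = e then h.choose else 0
  obtain ⟨g, f, g1, g2, g3⟩ := ramsey _ hinf B (pr z)
  refine ⟨f, ⟨g, g1, fun n => (g2 n).choose_spec.2.1, fun n m h => (g3 n m h).2⟩, ?_⟩
  have hB : B (g 0) = (g2 0).choose := dif_pos (g2 0)
  obtain ⟨a1, a2, a3⟩ := (g2 0).choose_spec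
  rw [← hB] at a1 a3
  obtain ⟨b1, b2⟩ := g3 0 1 (by omega)
  have := pr_mul z a1.le b1
  rw [a3, b2] at this
  rw [← this, ← mul_assoc, hee]

theorem core [Finite M] (P : (ℕ → M) → Prop)
    (hP : ∀ z z' s e, TP z s e → TP z' s e → (P z ↔ P z'))
    (z z' : ℕ → M)
    (hz : ∀ s e, {k | Hit z s e k}.Infinite ↔ {k | Hit z' s e k}.Infinite) : P z ↔ P z' := by
  have conj : ∀ x y s e f, TP x s e → TP y s f → e * f = f → f * e = e → (P x ↔ P y) := by
    intro x y s e f hx hy hef hfe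
    let w : ℕ → M := fun n => if n = 0 then s else if n % 2 = 1 then e else f
    have w0 : w 0 = s := rfl
    have w1 : ∀ n, w (2*n+1) = e := fun n => by
      simp only [w]; rw [if_neg (by omega), if_pos (by omega)]
    have w2 : ∀ n, w (2*n+2) = f := fun n => by
      simp only [w]; rw [if_neg (by omega), if_neg (by omega)]
    have t1 : TP w s f := by
      refine TP.of_succ (fun n => 2*n+1) (fun a b h => by simp; omega) ?_ ?_ hy.link hy.idem
      · exact pr_one w 0
      · intro n
        show pr w (2*n+1) (2*n+2+1) = f
        rw [pr_succ w (by omega), pr_one, w1, w2, hef]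
    have t2 : TP w s e := by
      refine TP.of_succ (fun n => 2*n+2) (fun a b h => by simp; omega) ?_ ?_ hx.link hx.idem
      · show pr w 0 (0+1+1) = s
        rw [pr_succ w (by omega), pr_one, w0]
        exact (congrArg (s * ·) (w1 0)).trans hx.link
      · intro n
        show pr w (2*n+2) (2*(n+1)+1+1) = e
        rw [pr_succ w (by omega), w1]
        show pr w (2*n+2) (2*n+2+1) * e = e
        rw [pr_one, w2, hfe]
    exact (hP _ _ _ _ hx t2).trans (hP _ _ _ _ t1 hy)
  let μ : M → ℕ := fun e => {g : M | e * g = g}.ncard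
  have hex : ∃ n, ∃ s e, (TP z s e ∨ TP z' s e) ∧ μ e = n := by
    obtain ⟨s, e, h⟩ := TP.exists z
    exact ⟨_, s, e, Or.inl h, rfl⟩
  classical
  obtain ⟨s, e, h, hn⟩ := Nat.find_spec hex
  have hmin : ∀ s' f, (TP z s' f ∨ TP z' s' f) → e * f = f → f * e = e := by
    intro s' f hf hef
    have h1 : μ e ≤ μ f := by
      rw [hn]; exact Nat.find_min' hex ⟨s', f, hf, rfl⟩
    have hee : e * e = e := by
      rcases h with h | h <;> exact h.idem
    have hsub : {g : M | f * g = g} ⊆ {g : M | e * g = g} := by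
      intro g (hg : f * g = g)
      show e * g = g
      rw [← hg, ← mul_assoc, hef]
    have heq := Set.eq_of_subset_of_ncard_le hsub h1 (Set.toFinite _)
    have : e ∈ {g : M | e * g = g} := hee
    rw [← heq] at this
    exact this
  rcases h with h | h
  · obtain ⟨f, hf, hef⟩ := TP.of_hit ((hz s e).1 h.hit) h.idem
    exact conj _ _ _ _ _ h hf hef (hmin _ _ (Or.inr hf) hef)
  · obtain ⟨f, hf, hef⟩ := TP.of_hit ((hz s e).2 h.hit) h.idem
    exact (conj _ _ _ _ _ h hf hef (hmin _ _ (Or.inl hf) hef)).symm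

/-- deterministic transition -/
def step {α : Type*} (μ : α → M) (q : M × (M → M → Set M)) (a : α) : M × (M → M → Set M) :=
  (q.1 * μ a, fun s e => {v | (∃ u ∈ q.2 s e, u ≠ e ∧ v = u * μ a) ∨ (q.1 = s ∧ v = μ a)})

theorem detRun_step {α : Type*} (μ : α → M) (x : ℕ → α) (k : ℕ) :
    detRun (step μ) (1, fun _ _ => ∅) x k = (pr (fun n => μ (x n)) 0 k, fun s e =>
      {v | ∃ i, i < k ∧ pr (fun n => μ (x n)) 0 i = s ∧ pr (fun n => μ (x n)) i k = v ∧
        ∀ j, i < j → j < k → pr (fun n => μ (x n)) i j ≠ e}) := by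
  induction k with
  | zero =>
    show ((1 : M), (fun _ _ => ∅ : M → M → Set M)) = _
    rw [pr_self]; simp
  | succ k ih =>
    show step μ (detRun (step μ) (1, fun _ _ => ∅) x k) (x k) = _
    rw [ih]
    set z := fun n => μ (x n) with hz
    have hzk : μ (x k) = z k := rfl
    refine Prod.ext (pr_succ z (by omega)).symm ?_
    funext s e
    ext v
    simp only [step, Set.mem_ofPred_eq, hzk]
    constructor
    · rintro (⟨u, ⟨i, a1, a2, a3, a4⟩, hu, rfl⟩ | ⟨h, rfl⟩)
      · refine ⟨i, by omega, a2, by rw [pr_succ z (by omega), a3], fun j hj hj' => ?_⟩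
        rcases Nat.lt_succ_iff_lt_or_eq.1 hj' with h | rfl
        · exact a4 j hj h
        · rw [a3]; exact hu
      · exact ⟨k, by omega, h, pr_one z k, fun j hj hj' => by omega⟩
    · rintro ⟨i, a1, a2, rfl, a4⟩
      rcases Nat.lt_succ_iff_lt_or_eq.1 a1 with h | rfl
      · left
        exact ⟨pr z i k, ⟨i, h, a2, rfl, fun j hj hj' => a4 j hj (by omega)⟩, a4 k h (by omega),
          pr_succ z (by omega)⟩
      · right
        exact ⟨a2, pr_one z i⟩

end core

theorem inf_mem_iff {Q : Type*} [Finite Q] (r : ℕ → Q) (P : Q → Prop) :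
    {n | P (r n)}.Infinite ↔ ∃ q ∈ {q | {n | r n = q}.Infinite}, P q := by
  constructor
  · intro h
    by_contra hcon
    push Not at hcon
    apply h
    have : {n | P (r n)} ⊆ ⋃ q ∈ {q | P q}, {n | r n = q} := by
      intro n hn
      simp only [Set.mem_iUnion]
      exact ⟨r n, hn, rfl⟩
    refine (Set.Finite.biUnion (Set.toFinite _) fun q hq => ?_).subset this
    by_contra hq'
    exact hcon q hq' hq
  · rintro ⟨q, hq, hP⟩
    refine Set.Infinite.mono ?_ hq
    rintro n rfl
    exact hP

theorem acc_sat {K : Type} (q₀ : K) (z : ℕ → Prof K) (s e : Prof K) (h : TP z s e) :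
    Acc q₀ z ↔ Acc q₀ (fun n => if n = 0 then s else e) := by
  obtain ⟨g, hg, h1, h2⟩ := h
  rw [acc_group q₀ z (fun n => if n = 0 then 0 else g n) ?_ rfl]
  · apply iff_of_eq
    congr 1
    funext n
    by_cases hn : n = 0
    · subst hn; simp [h1]
    · simp [hn, h2 n (n+1) (by omega)]
  · intro a b hab
    have hb : b ≠ 0 := by omega
    have := hg hab
    by_cases ha : a = 0
    · simp only [ha, hb, if_true, if_false]; subst ha; omega
    · simpa only [ha, hb, if_false]

theorem nba_to_dma {α : Type*} {K : Type} [Finite K] (δ : K → α → Set K) (q₀ : K) (F : Set K) :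
    ∃ (K' : Type) (_ : Fintype K') (δ' : K' → α → K') (q₀' : K') (𝓕 : Set (Set K')),
        nbaLang δ q₀ F = dmaLang δ' q₀' 𝓕 := by
  classical
  let μ : α → Prof K := fun a p b q => q ∈ δ p a ∧ (b = true ↔ q ∈ F)
  have hL : ∀ x, x ∈ nbaLang δ q₀ F ↔ Acc q₀ (fun n => μ (x n)) := by
    intro x
    constructor
    · rintro ⟨r, r0, r1, r2⟩
      refine ⟨r, fun n => decide (r (n+1) ∈ F), r0, fun n => ⟨r1 n, by simp⟩, fun N => ?_⟩
      obtain ⟨n, hn, hN⟩ := Set.infinite_iff_exists_gt.1 r2 N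
      refine ⟨n - 1, by omega, ?_⟩
      show decide (r (n - 1 + 1) ∈ F) = true
      rw [Nat.sub_add_cancel (show 1 ≤ n by omega)]
      simpa using hn
    · rintro ⟨q, b, h0, h1, h2⟩
      refine ⟨q, h0, fun n => (h1 n).1, ?_⟩
      rw [Set.infinite_iff_exists_gt]
      intro N
      obtain ⟨n, hn, hb⟩ := h2 N
      exact ⟨n+1, (h1 n).2.1 hb, by omega⟩
  let Q := Prof K × (Prof K → Prof K → Set (Prof K))
  have hfin : Finite Q := by infer_instance
  let q₀' : Q := (1, fun _ _ => ∅)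
  let Inf : (ℕ → α) → Set Q := fun x => {q | {n | detRun (step μ) q₀' x n = q}.Infinite}
  refine ⟨Q, Fintype.ofFinite Q, step μ, q₀', {I | ∃ x ∈ nbaLang δ q₀ F, I = Inf x}, ?_⟩
  have hit : ∀ x s e, {k | Hit (fun n => μ (x n)) s e k}.Infinite ↔
      ∃ q ∈ Inf x, e ∈ q.2 s e := by
    intro x s e
    rw [← inf_mem_iff (detRun (step μ) q₀' x) (fun q => e ∈ q.2 s e)]
    apply iff_of_eq
    congr 1
    ext k
    simp only [q₀', detRun_step]
    rfl
  ext x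
  constructor
  · intro hx
    exact ⟨x, hx, rfl⟩
  · rintro ⟨y, hy, hxy⟩
    have hxy : Inf x = Inf y := hxy
    rw [hL] at hy ⊢
    refine (core (Acc q₀) ?_ _ _ ?_).2 hy
    · intro z z' s e h h'
      rw [acc_sat q₀ z s e h, acc_sat q₀ z' s e h']
    · intro s e
      rw [hit, hit, hxy]

theorem dma_to_nma {α : Type*} {K : Type} (δ : K → α → K) (q₀ : K) (𝓕 : Set (Set K)) :
    dmaLang δ q₀ 𝓕 = nmaLang (fun q a => {δ q a}) q₀ 𝓕 := by
  ext x
  constructor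
  · intro h
    exact ⟨detRun δ q₀ x, rfl, fun n => rfl, h⟩
  · rintro ⟨r, h0, h1, h2⟩
    have : r = detRun δ q₀ x := by
      funext n
      induction n with
      | zero => exact h0
      | succ n ih =>
        have := h1 n
        rw [Set.mem_singleton_iff, ih] at this
        exact this
    rw [this] at h2
    exact h2

/-- counter update of the Büchi automaton simulating a Muller automaton -/
def CStep {K : Type} (𝓕 : Set (Set K)) (c : Option (Set K × Set K)) (q' : K)
    (c' : Option (Set K × Set K)) : Prop :=
  (c = none ∧ c' = none) ∨ (c = none ∧ ∃ S ∈ 𝓕, q' ∈ S ∧ c' = some (S, ∅)) ∨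
  (∃ S V, c = some (S, V) ∧ q' ∈ S ∧
    ((V = S ∧ c' = some (S, ∅)) ∨ (V ≠ S ∧ c' = some (S, insert q' V))))

theorem nma_to_nba {α : Type*} {K : Type} [Finite K] (δ : K → α → Set K) (q₀ : K)
    (𝓕 : Set (Set K)) :
    ∃ (K' : Type) (_ : Fintype K') (δ' : K' → α → Set K') (q₀' : K') (F : Set K'),
        nmaLang δ q₀ 𝓕 = nbaLang δ' q₀' F := by
  classical
  refine ⟨Option (Set K × Set K) × K, Fintype.ofFinite _,
    fun p a => {p' | p'.2 ∈ δ p.2 a ∧ CStep 𝓕 p.1 p'.2 p'.1}, (none, q₀),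
    {p | ∃ S, p.1 = some (S, S)}, ?_⟩
  ext x
  constructor
  · rintro ⟨r, r0, r1, r2⟩
    set S := {q : K | {n : ℕ | r n = q}.Infinite} with hS
    have hev : ∀ᶠ n in atTop, r n ∈ S := by
      have : ∀ q, q ∉ S → ∀ᶠ n in atTop, r n ≠ q := by
        intro q hq
        have hq : {n | r n = q}.Finite := Set.not_infinite.1 hq
        rw [← Nat.cofinite_eq_atTop]
        exact hq.eventually_cofinite_notMem
      have := eventually_all.2 fun q => (eventually_imp_distrib_left.2 (this q))
      filter_upwards [this] with n hn
      by_contra hcon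
      exact hn _ hcon rfl
    obtain ⟨N, hN⟩ := eventually_atTop.1 hev
    obtain ⟨V, V0, Vs⟩ : ∃ V : ℕ → Set K, V 0 = ∅ ∧
        ∀ n : ℕ, V (n+1) = (if V n = S then (∅ : Set K) else insert (r (N + n + 2)) (V n)) :=
      ⟨fun n => Nat.rec (motive := fun _ => Set K) ∅
        (fun n V => if V = S then (∅ : Set K) else insert (r (N + n + 2)) V) n,
        rfl, fun n => rfl⟩
    have Vsub : ∀ n, V n ⊆ S := by
      intro n
      induction n with
      | zero => simp [V0]
      | succ n ih =>
        rw [Vs]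
        split_ifs
        · simp
        · exact Set.insert_subset (hN _ (by omega)) ih
    refine ⟨fun n => (if n ≤ N then none else some (S, V (n - (N+1))), r n), ?_, ?_, ?_⟩
    · simp [r0]
    · intro n
      refine ⟨r1 n, ?_⟩
      show CStep 𝓕 (if n ≤ N then none else some (S, V (n - (N+1)))) (r (n+1))
        (if n + 1 ≤ N then none else some (S, V (n + 1 - (N+1))))
      rcases lt_trichotomy n N with h | rfl | h
      · left
        rw [if_pos h.le, if_pos (Nat.succ_le_of_lt h)]; exact ⟨rfl, rfl⟩
      · right; left
        rw [if_pos le_rfl, if_neg (by omega)]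
        exact ⟨rfl, S, r2, hN _ (by omega), by simp [V0]⟩
      · right; right
        obtain ⟨k, rfl⟩ := Nat.exists_eq_add_of_lt h
        rw [if_neg (by omega), if_neg (by omega)]
        have e1 : N + k + 1 - (N+1) = k := by omega
        have e2 : N + k + 1 + 1 - (N+1) = k + 1 := by omega
        rw [e1, e2, Vs]
        refine ⟨S, V k, rfl, hN _ (by omega), ?_⟩
        by_cases hV : V k = S
        · left; simp [hV]
        · right; simp [hV]
    · have hVinf : ∀ n1, ∃ n, n1 ≤ n ∧ V n = S := by
        intro n1
        by_contra hcon
        push Not at hcon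
        have Vi : ∀ n, n1 ≤ n → V (n+1) = insert (r (N+n+2)) (V n) := fun n hn => by
          rw [Vs, if_neg (hcon n hn)]
        have hq : ∀ q, q ∈ S → ∀ᶠ n in atTop, q ∈ V n := by
          intro q hq
          obtain ⟨m, hm, hmN⟩ := Set.infinite_iff_exists_gt.1 hq (N + n1 + 2)
          obtain ⟨k, rfl⟩ : ∃ k, m = N + k + 2 := ⟨m - N - 2, by omega⟩
          refine eventually_atTop.2 ⟨k+1, fun n hn => ?_⟩
          induction n, hn using Nat.le_induction with
          | base => rw [Vi k (by omega)]; left; exact hm.symm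
          | succ n hn ih => rw [Vi n (by omega)]; right; exact ih
        have := eventually_all.2 fun q => (eventually_imp_distrib_left.2 (hq q))
        obtain ⟨n, h1, h2⟩ := (this.and (eventually_ge_atTop n1)).exists
        exact hcon n h2 (Set.Subset.antisymm (Vsub n) h1)
      rw [Set.infinite_iff_exists_gt]
      intro n1
      obtain ⟨n, h1, h2⟩ := hVinf n1
      refine ⟨n + (N+1), ⟨S, ?_⟩, by omega⟩
      show (if n + (N+1) ≤ N then none else some (S, V (n + (N+1) - (N+1)))) = some (S, S)
      rw [if_neg (by omega), Nat.add_sub_cancel, h2]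
  · rintro ⟨r, r0, r1, r2⟩
    have inv : ∀ n, (r n).1 = none ∨ ∃ S ∈ 𝓕, ∃ V, (r n).1 = some (S, V) := by
      intro n
      induction n with
      | zero => left; rw [r0]
      | succ n ih =>
        rcases (r1 n).2 with ⟨-, h⟩ | ⟨-, S, hS, -, h⟩ | ⟨S, V, hc, -, h⟩
        · left; exact h
        · right; exact ⟨S, hS, _, h⟩
        · right
          rw [hc] at ih
          rcases ih with ih | ⟨S', hS', V', h'⟩
          · simp at ih
          · simp only [Option.some.injEq, Prod.mk.injEq] at h'
            rw [← h'.1] at hS'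
            rcases h with ⟨-, h⟩ | ⟨-, h⟩
            · exact ⟨S, hS', _, h⟩
            · exact ⟨S, hS', _, h⟩
    obtain ⟨n0, ⟨S, hn0⟩, -⟩ := Set.infinite_iff_exists_gt.1 r2 0
    have hS : S ∈ 𝓕 := by
      rcases inv n0 with h | ⟨S', hS', V', h'⟩
      · rw [hn0] at h; simp at h
      · rw [hn0] at h'
        simp only [Option.some.injEq, Prod.mk.injEq] at h'
        rw [h'.1]; exact hS'
    have stp : ∀ n V, (r n).1 = some (S, V) → (r (n+1)).2 ∈ S ∧
        ((V = S ∧ (r (n+1)).1 = some (S, ∅)) ∨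
         (V ≠ S ∧ (r (n+1)).1 = some (S, insert (r (n+1)).2 V))) := by
      intro n V hV
      rcases (r1 n).2 with ⟨h, -⟩ | ⟨h, -⟩ | ⟨S', V', hc, h1, h2⟩
      · rw [hV] at h; simp at h
      · rw [hV] at h; simp at h
      · rw [hV] at hc
        simp only [Option.some.injEq, Prod.mk.injEq] at hc
        obtain ⟨rfl, rfl⟩ := hc
        exact ⟨h1, h2⟩
    have stay : ∀ n, n0 ≤ n → ∃ V, (r n).1 = some (S, V) := by
      intro n hn
      induction n, hn using Nat.le_induction with
      | base => exact ⟨S, hn0⟩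
      | succ n hn ih =>
        obtain ⟨V, hV⟩ := ih
        rcases (stp n V hV).2 with ⟨-, h⟩ | ⟨-, h⟩
        · exact ⟨_, h⟩
        · exact ⟨_, h⟩
    have full : ∀ N, ∃ n, N < n ∧ n0 ≤ n ∧ (r n).1 = some (S, S) := by
      intro N
      obtain ⟨n, ⟨S', hn⟩, hN⟩ := Set.infinite_iff_exists_gt.1 r2 (max N n0)
      have hn0' : n0 ≤ n := by omega
      obtain ⟨V, hV⟩ := stay n hn0'
      have := hV
      rw [hn] at this
      simp only [Option.some.injEq, Prod.mk.injEq] at this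
      rw [this.1] at hn
      exact ⟨n, by omega, hn0', hn⟩
    refine ⟨fun n => (r n).2, by simp [r0], fun n => (r1 n).1, ?_⟩
    convert hS
    ext q
    constructor
    · intro hq
      obtain ⟨n, hn, hn'⟩ := Set.infinite_iff_exists_gt.1 hq n0
      obtain ⟨k, rfl⟩ := Nat.exists_eq_add_of_lt hn'
      obtain ⟨V, hV⟩ := stay (n0 + k) (by omega)
      have := (stp _ V hV).1
      have hn : (r (n0+k+1)).2 = q := hn
      rwa [hn] at this
    · intro hq
      rw [Set.mem_ofPred_eq, Set.infinite_iff_exists_gt]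
      by_contra hcon
      push Not at hcon
      obtain ⟨N, hN⟩ := hcon
      obtain ⟨n1, h1, h2, h3⟩ := full N
      have key : ∀ n, n1 + 1 ≤ n → ∃ V, (r n).1 = some (S, V) ∧ q ∉ V := by
        intro n hn
        induction n, hn using Nat.le_induction with
        | base =>
          rcases (stp n1 S h3).2 with ⟨-, h⟩ | ⟨h, -⟩
          · exact ⟨_, h, by simp⟩
          · exact absurd rfl h
        | succ n hn ih =>
          obtain ⟨V, hV, hqV⟩ := ih
          rcases (stp n V hV).2 with ⟨-, h⟩ | ⟨-, h⟩
          · exact ⟨_, h, by simp⟩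
          · refine ⟨_, h, ?_⟩
            rintro (h' | h')
            · have := hN (n+1) h'.symm
              omega
            · exact hqV h'
      obtain ⟨n2, a1, -, a3⟩ := full (n1 + 1)
      obtain ⟨V, hV, hqV⟩ := key n2 a1.le
      rw [a3] at hV
      simp only [Option.some.injEq, Prod.mk.injEq, true_and] at hV
      rw [← hV] at hqV
      exact hqV hq

end McN

/-- McNaughton's theorem: an ω-language `L ⊆ α^ω` is accepted by a
nondeterministic Büchi automaton with finite state set iff it is accepted by a
deterministic Muller automaton with finite state set; moreover these conditions are
also equivalent to acceptance by a nondeterministic Muller automaton with finite state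
set. -/
theorem mcnaughton
    {α : Type*} [Fintype α] [Nonempty α] (L : Set (ℕ → α)) :
    ((∃ (K : Type) (_ : Fintype K) (δ : K → α → Set K) (q₀ : K) (F : Set K),
        L = nbaLang δ q₀ F) ↔
      (∃ (K : Type) (_ : Fintype K) (δ : K → α → K) (q₀ : K) (𝓕 : Set (Set K)),
        L = dmaLang δ q₀ 𝓕)) ∧
    ((∃ (K : Type) (_ : Fintype K) (δ : K → α → Set K) (q₀ : K) (F : Set K),
        L = nbaLang δ q₀ F) ↔
      (∃ (K : Type) (_ : Fintype K) (δ : K → α → Set K) (q₀ : K) (𝓕 : Set (Set K)),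
        L = nmaLang δ q₀ 𝓕)) := by
  constructor
  · constructor
    · rintro ⟨K, _, δ, q₀, F, rfl⟩
      exact McN.nba_to_dma δ q₀ F
    · rintro ⟨K, _, δ, q₀, 𝓕, rfl⟩
      rw [McN.dma_to_nma]
      exact McN.nma_to_nba _ q₀ 𝓕
  · constructor
    · rintro ⟨K, _, δ, q₀, F, rfl⟩
      obtain ⟨K', hK', δ', q₀', 𝓕, h⟩ := McN.nba_to_dma δ q₀ F
      exact ⟨K', hK', _, q₀', 𝓕, h.trans (McN.dma_to_nma δ' q₀' 𝓕)⟩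
    · rintro ⟨K, _, δ, q₀, 𝓕, rfl⟩
      exact McN.nma_to_nba δ q₀ 𝓕
end

section
/- Let Σ be a nonempty finite alphabet and let L ⊆ Σ^ω be an ω-regular language, i.e. L is accepted by some nondeterministic Büchi automaton with finite state set. Then L is a Π⁰₂ (i.e. Gδ) subset of the Cantor space Σ^ω if and only if L is accepted by some deterministic Büchi automaton with finite state set. -/
/-- The ω-language accepted by the deterministic Büchi automaton `(K, δ, q₀, F)`. -/
def dbaLang {α K : Type*} (δ : K → α → K) (q₀ : K) (F : Set K) : Set (ℕ → α) :=
  {x | {n : ℕ | detRun δ q₀ x n ∈ F}.Infinite}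

namespace LW

/-- The factor of `x` on positions `[i, j)`. -/
def seg {α : Type*} (x : ℕ → α) (i j : ℕ) : List α := (List.Ico i j).map x

/-- Value of a word in a monoid. -/
def pw {α S : Type*} [Monoid S] (ψ : α → S) (w : List α) : S := (w.map ψ).prod

/-- Value of a factor in a monoid. -/
def ph {α S : Type*} [Monoid S] (ψ : α → S) (x : ℕ → α) (i j : ℕ) : S := pw ψ (seg x i j)

section basic
variable {α S : Type*} [Monoid S] (ψ : α → S)

lemma seg_append (x : ℕ → α) {i j k : ℕ} (h : i ≤ j) (h' : j ≤ k) :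
    seg x i j ++ seg x j k = seg x i k := by
  rw [seg, seg, seg, ← List.map_append, List.Ico.append_consecutive h h']

lemma seg_succ (x : ℕ → α) {i j : ℕ} (h : i ≤ j) :
    seg x i (j + 1) = seg x i j ++ [x j] := by
  simp [seg, List.Ico.succ_top h]

lemma seg_length (x : ℕ → α) (i j : ℕ) : (seg x i j).length = j - i := by
  simp [seg]

lemma seg_self (x : ℕ → α) (i : ℕ) : seg x i i = [] := by
  simp [seg]

lemma seg_eq_zero {x y : ℕ → α} {n : ℕ} (h : seg x 0 n = seg y 0 n) :
    ∀ i < n, x i = y i := by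
  intro i hi
  have := List.map_inj_left.1 h i (by simp [hi])
  exact this

lemma pw_append (u v : List α) : pw ψ (u ++ v) = pw ψ u * pw ψ v := by
  simp [pw]

lemma ph_mul (x : ℕ → α) {i j k : ℕ} (h : i ≤ j) (h' : j ≤ k) :
    ph ψ x i j * ph ψ x j k = ph ψ x i k := by
  rw [ph, ph, ph, ← pw_append, seg_append x h h']

lemma ph_succ (x : ℕ → α) {i j : ℕ} (h : i ≤ j) :
    ph ψ x i (j + 1) = ph ψ x i j * ψ (x j) := by
  rw [ph, ph, seg_succ x h, pw_append]; simp [pw]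

lemma ph_self (x : ℕ → α) (i : ℕ) : ph ψ x i i = 1 := by
  simp [ph, seg_self, pw]

/-- Limit of a growing sequence of words. -/
lemma exists_limit (w : ℕ → List α) (h : ∀ k, ∃ z, z ≠ [] ∧ w (k + 1) = w k ++ z) :
    ∃ x : ℕ → α, ∀ k, seg x 0 (w k).length = w k := by
  have hlen : ∀ k, k ≤ (w k).length := by
    intro k
    induction k with
    | zero => simp
    | succ k ih =>
      obtain ⟨z, hz, e⟩ := h k
      have := List.length_pos_iff.2 hz
      rw [e, List.length_append]; omega
  have hpre : ∀ k l, k ≤ l → w k <+: w l := by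
    intro k l hkl
    induction l, hkl using Nat.le_induction with
    | base => exact List.prefix_rfl
    | succ l _ ih =>
      obtain ⟨z, _, e⟩ := h l
      exact ih.trans (by rw [e]; exact List.prefix_append _ _)
  refine ⟨fun i => (w (i + 1))[i]'(hlen (i + 1)), fun k => ?_⟩
  apply List.ext_getElem
  · simp [seg_length]
  · intro i h1 h2
    simp only [seg, List.getElem_map]
    have e : (List.Ico 0 (w k).length)[i]'(by simpa using h2) = i := by
      simp [List.Ico]
    simp only [e]
    rcases le_total k (i + 1) with hk | hk
    · exact ((hpre _ _ hk).getElem h2).symm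
    · exact (hpre _ _ hk).getElem (hlen (i + 1))

lemma seg_limit {x : ℕ → α} {w z : List α} (h : seg x 0 w.length = w)
    (h' : seg x 0 (w ++ z).length = w ++ z) : seg x w.length (w ++ z).length = z := by
  rw [← seg_append x (Nat.zero_le w.length) (by simp), h] at h'
  exact List.append_cancel_left h'

end basic

lemma ramsey {S : Type*} [Finite S] (c : ℕ → ℕ → S) (A : Set ℕ) (hA : A.Infinite) :
    ∃ (e : S) (n : ℕ → ℕ), StrictMono n ∧ (∀ k, n k ∈ A) ∧ ∀ i j, i < j → c (n i) (n j) = e := by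
  have hne : (Filter.atTop ⊓ Filter.principal A : Filter ℕ).NeBot := by
    rw [← Filter.frequently_mem_iff_neBot]
    exact Nat.frequently_atTop_iff_infinite.2 hA
  let U : Ultrafilter ℕ := Ultrafilter.of (Filter.atTop ⊓ Filter.principal A)
  have hU : (U : Filter ℕ) ≤ Filter.atTop ⊓ Filter.principal A := Ultrafilter.of_le _
  have hUA : ∀ᶠ q in (U : Filter ℕ), q ∈ A :=
    (hU.trans inf_le_right) (Filter.mem_principal_self A)
  have hUt : ∀ p, ∀ᶠ q in (U : Filter ℕ), p < q := fun p =>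
    (hU.trans inf_le_left) (Filter.eventually_gt_atTop p)
  have fin : ∀ f : ℕ → S, ∃ e, ∀ᶠ q in (U : Filter ℕ), f q = e := by
    intro f
    have := (Ultrafilter.eventually_exists_iff (f := U) (P := fun (e : S) q => f q = e)).1
      (Filter.Eventually.of_forall fun q => ⟨f q, rfl⟩)
    exact this
  choose g hg using fun p => fin (c p)
  obtain ⟨e, he⟩ := fin g
  obtain ⟨n, hn1, hn2⟩ := exists_seq_of_forall_finset_exists
    (fun p => p ∈ A ∧ g p = e) (fun p q => p < q ∧ c p q = e) (by
      intro s hs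
      have h1 : ∀ᶠ q in (U : Filter ℕ), ∀ x ∈ s, x < q ∧ c x q = e := by
        rw [Filter.eventually_all_finset]
        intro x hx
        have := hg x
        rw [(hs x hx).2] at this
        exact (hUt x).and this
      obtain ⟨y, ⟨hy1, hy2⟩, hy3⟩ := ((hUA.and he).and h1).exists
      exact ⟨y, ⟨hy1, hy2⟩, hy3⟩)
  exact ⟨e, n, fun i j h => (hn2 i j h).1, fun k => (hn1 k).1, fun i j h => (hn2 i j h).2⟩

lemma open_agree {α : Type*} [TopologicalSpace α] {U : Set (ℕ → α)} (hU : IsOpen U)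
    {y : ℕ → α} (hy : y ∈ U) : ∃ N, ∀ x : ℕ → α, (∀ i < N, x i = y i) → x ∈ U := by
  obtain ⟨I, u, h1, h2⟩ := isOpen_pi_iff.1 hU y hy
  refine ⟨I.sup id + 1, fun x hx => h2 ?_⟩
  intro i hi
  have : i ≤ I.sup id := Finset.le_sup (f := id) hi
  rw [hx i (by omega)]
  exact (h1 i hi).2

section core
variable {α : Type*} {S : Type*} [Monoid S] (ψ : α → S) (L : Set (ℕ → α))

/-- `x` splits as a word of value `s` followed by words of value `e`. -/
def Typ (s e : S) (x : ℕ → α) (m : ℕ → ℕ) : Prop :=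
  StrictMono m ∧ 0 < m 0 ∧ ph ψ x 0 (m 0) = s ∧ ∀ k, ph ψ x (m k) (m (k + 1)) = e

/-- Membership in `L` only depends on the type. -/
def Sat : Prop := ∀ s e x y n m, Typ ψ s e x n → Typ ψ s e y m → x ∈ L → y ∈ L

/-- Accepting values. -/
def Acc (s g : S) : Prop :=
  ∃ (a : List α) (e : S) (f : List α), g = pw ψ a * e * pw ψ f ∧ s * pw ψ a = s ∧ s * e = s ∧
    s * pw ψ f = s ∧ e * e = e ∧ ∃ y ∈ L, ∃ m, Typ ψ s e y m

lemma Acc.stab {s g : S} (h : Acc ψ L s g) : s * g = s := by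
  obtain ⟨a, e, f, rfl, h1, h2, h3, -⟩ := h
  rw [← mul_assoc, ← mul_assoc, h1, h2, h3]

lemma Acc.right {s g : S} (h : Acc ψ L s g) (v : List α) (hv : s * pw ψ v = s) :
    Acc ψ L s (g * pw ψ v) := by
  obtain ⟨a, e, f, rfl, h1, h2, h3, h4⟩ := h
  refine ⟨a, e, f ++ v, ?_, h1, h2, ?_, h4⟩
  · rw [pw_append]; simp only [mul_assoc]
  · rw [pw_append, ← mul_assoc, h3, hv]

lemma key [TopologicalSpace α] (hG : IsGδ L) (hS : Sat ψ L) {s g : S} (h : Acc ψ L s g)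
    (x : ℕ → α) (n : ℕ → ℕ) (hx : Typ ψ s g x n) : x ∈ L := by
  have hsg := h.stab
  obtain ⟨a, e, f, hg, h1, h2, h3, h4, y, hy, m, hm⟩ := h
  obtain ⟨U, hUo, hUL⟩ := isGδ_iff_eq_iInter_nat.1 hG
  have hm' := hm
  obtain ⟨m1, m2, m3, m4⟩ := hm'
  have hseg : ∀ j, ph ψ y (m 0) (m (j + 1)) = e := by
    intro j
    induction j with
    | zero => exact m4 0
    | succ j ih =>
      rw [← ph_mul ψ y (m1.monotone (Nat.zero_le (j + 1))) (m1.monotone (Nat.le_succ (j + 1))),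
        ih, m4, h4]
  have step : ∀ (k : ℕ) (w : List α), pw ψ w = s → w ≠ [] → ∃ z : List α, z ≠ [] ∧
      pw ψ z = g ∧ ∀ x, seg x 0 (w ++ z).length = w ++ z → x ∈ U k := by
    intro k w hw hw0
    let w' : ℕ → List α := fun j => (w ++ a) ++ seg y (m 0) (m j)
    have hw' : ∀ j, w' (j + 1) = w' j ++ seg y (m j) (m (j + 1)) := by
      intro j
      simp only [w']
      rw [← seg_append y (m1.monotone (Nat.zero_le j)) (m1.monotone (Nat.le_succ j))]
      simp only [List.append_assoc]
    have hne : ∀ j, seg y (m j) (m (j + 1)) ≠ [] := by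
      intro j
      rw [← List.length_pos_iff, seg_length]
      have := m1 (Nat.lt_succ_self j)
      simp only [Nat.succ_eq_add_one] at this
      omega
    obtain ⟨t, ht⟩ := exists_limit w' (fun j => ⟨_, hne j, hw' j⟩)
    have htm : StrictMono fun j => (w' j).length := by
      apply strictMono_nat_of_lt_succ
      intro j
      have := List.length_pos_iff.2 (hne j)
      simp only [hw', List.length_append (as := w' j)]
      omega
    have htL : t ∈ L := by
      refine hS s e y t m (fun j => (w' j).length) hm ⟨htm, ?_, ?_, ?_⟩ hy
      · have := List.length_pos_iff.2 hw0
        simp only [w', List.length_append]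
        omega
      · simp only [ph, ht]
        simp only [w', seg_self, List.append_nil, pw_append, hw, h1]
      · intro j
        have e1 := ht (j + 1)
        rw [hw'] at e1
        simp only [hw', ph]
        rw [seg_limit (ht j) e1]
        exact m4 j
    have htU : t ∈ U k := by
      rw [hUL] at htL
      exact Set.mem_iInter.1 htL k
    obtain ⟨N, hN⟩ := open_agree (hUo k) htU
    refine ⟨a ++ seg y (m 0) (m (N + 1)) ++ f, ?_, ?_, ?_⟩
    · have : seg y (m 0) (m (N + 1)) ≠ [] := by
        rw [← List.length_pos_iff, seg_length]
        have := m1 (Nat.succ_pos N)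
        simp only [Nat.succ_eq_add_one] at this
        omega
      simp [this]
    · rw [pw_append, pw_append, hg]
      have := hseg N
      rw [ph] at this
      rw [this]
    · intro x hx
      apply hN
      have e1 : w ++ (a ++ seg y (m 0) (m (N + 1)) ++ f) = w' (N + 1) ++ f := by
        simp only [w', List.append_assoc]
      rw [e1] at hx
      rw [← seg_append x (Nat.zero_le (w' (N + 1)).length) (by simp)] at hx
      have hx2 := List.append_inj_left hx (by simp [seg_length])
      rw [← ht (N + 1)] at hx2
      simp only [seg_length, Nat.sub_zero] at hx2
      intro i hi
      refine seg_eq_zero hx2 i ?_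
      have := htm.le_apply (x := N + 1)
      omega
  choose! z hz1 hz2 hz3 using step
  let w : ℕ → List α := fun k => Nat.rec (seg y 0 (m 0)) (fun k w => w ++ z k w) k
  have hwS : ∀ k, w (k + 1) = w k ++ z k (w k) := fun k => rfl
  have hw0 : w 0 = seg y 0 (m 0) := rfl
  have hw : ∀ k, pw ψ (w k) = s ∧ w k ≠ [] := by
    intro k
    induction k with
    | zero =>
      refine ⟨m3, ?_⟩
      rw [← List.length_pos_iff, hw0, seg_length]
      omega
    | succ k ih =>
      rw [hwS, pw_append, ih.1, hz2 k _ ih.1 ih.2]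
      exact ⟨hsg, by simp [ih.2]⟩
  obtain ⟨t, ht⟩ := exists_limit w (fun k => ⟨_, hz1 k _ (hw k).1 (hw k).2, hwS k⟩)
  have htL : t ∈ L := by
    rw [hUL]
    refine Set.mem_iInter.2 fun k => ?_
    refine hz3 k _ (hw k).1 (hw k).2 t ?_
    have := ht (k + 1)
    rwa [hwS] at this
  refine hS s g t x (fun k => (w k).length) n ⟨?_, ?_, ?_, ?_⟩ hx htL
  · apply strictMono_nat_of_lt_succ
    intro k
    have := List.length_pos_iff.2 (hz1 k _ (hw k).1 (hw k).2)
    rw [hwS, List.length_append]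
    omega
  · exact List.length_pos_iff.2 (hw 0).2
  · simp only [ph, ht, (hw 0).1]
  · intro k
    have e1 := ht (k + 1)
    rw [hwS] at e1
    simp only [hwS, ph]
    rw [seg_limit (ht k) e1]
    exact hz2 k _ (hw k).1 (hw k).2

open Classical in
/-- Transition function of the deterministic automaton attached to `s`. -/
noncomputable def dstep (s : S) : S ⊕ (S × Bool) → α → S ⊕ (S × Bool)
  | Sum.inl t, c => if t * ψ c = s then Sum.inr (1, false) else Sum.inl (t * ψ c)
  | Sum.inr (g, _), c =>
      if Acc ψ L s (g * ψ c) then Sum.inr (1, true) else Sum.inr (g * ψ c, false)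

/-- Accepting states. -/
def dacc : Set (S ⊕ (S × Bool)) := {q | ∃ g, q = Sum.inr (g, true)}

lemma run_succ (s : S) (x : ℕ → α) (n : ℕ) :
    detRun (dstep ψ L s) (Sum.inl 1) x (n + 1) =
      dstep ψ L s (detRun (dstep ψ L s) (Sum.inl 1) x n) (x n) := rfl

lemma run_inv (s : S) (x : ℕ → α) (n : ℕ) :
    (∃ t, detRun (dstep ψ L s) (Sum.inl 1) x n = Sum.inl t ∧ t = ph ψ x 0 n ∧ (0 < n → t ≠ s)) ∨
    (∃ g b, detRun (dstep ψ L s) (Sum.inl 1) x n = Sum.inr (g, b) ∧ s * g = ph ψ x 0 n ∧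
      (∃ v : List α, pw ψ v = g) ∧ (b = true → g = 1 ∧ 0 < n)) := by
  induction n with
  | zero => exact Or.inl ⟨1, rfl, (ph_self ψ x 0).symm, by simp⟩
  | succ n ih =>
    rw [run_succ, ph_succ ψ x (Nat.zero_le n)]
    rcases ih with ⟨t, h1, h2, h3⟩ | ⟨g, b, h1, h2, ⟨v, hv⟩, h3⟩
    · rw [h1, ← h2]
      by_cases hc : t * ψ (x n) = s
      · right
        exact ⟨1, false, by simp [dstep, hc], by simp [hc], ⟨[], by simp [pw]⟩, by simp⟩
      · left
        exact ⟨t * ψ (x n), by simp [dstep, hc], rfl, fun _ => hc⟩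
    · right
      rw [h1, ← h2, mul_assoc]
      by_cases hc : Acc ψ L s (g * ψ (x n))
      · exact ⟨1, true, by simp [dstep, hc], by simp [hc.stab], ⟨[], by simp [pw]⟩, by simp⟩
      · exact ⟨g * ψ (x n), false, by simp [dstep, hc], rfl,
          ⟨v ++ [x n], by rw [pw_append, hv]; simp [pw]⟩, by simp⟩

/-- Reading on from an `inr` state: either an accepting state is met, or the value accumulates. -/
lemma run_on (s : S) (x : ℕ → α) (p : ℕ) (g : S) (b : Bool)
    (h : detRun (dstep ψ L s) (Sum.inl 1) x p = Sum.inr (g, b)) (q : ℕ) (hpq : p < q) :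
    (∃ q', p < q' ∧ q' ≤ q ∧ detRun (dstep ψ L s) (Sum.inl 1) x q' ∈ dacc ∧
      Acc ψ L s (g * ph ψ x p q')) ∨
    (detRun (dstep ψ L s) (Sum.inl 1) x q = Sum.inr (g * ph ψ x p q, false) ∧
      ¬ Acc ψ L s (g * ph ψ x p q)) := by
  induction q, hpq using Nat.le_induction with
  | base =>
    rw [Nat.succ_eq_add_one, run_succ, h, ph_succ ψ x le_rfl, ph_self, one_mul]
    by_cases hc : Acc ψ L s (g * ψ (x p))
    · refine Or.inl ⟨p + 1, by omega, le_rfl, ?_, ?_⟩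
      · rw [run_succ, h]; exact ⟨1, by simp [dstep, hc]⟩
      · rwa [ph_succ ψ x le_rfl, ph_self, one_mul]
    · exact Or.inr ⟨by simp [dstep, hc], hc⟩
  | succ q hq ih =>
    have hq' : p ≤ q := by omega
    rcases ih with ⟨q', h1, h2, h3⟩ | ⟨h1, h2⟩
    · exact Or.inl ⟨q', h1, by omega, h3⟩
    · rw [run_succ, h1, ph_succ ψ x hq', ← mul_assoc]
      by_cases hc : Acc ψ L s (g * ph ψ x p q * ψ (x q))
      · refine Or.inl ⟨q + 1, by omega, le_rfl, ?_, ?_⟩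
        · rw [run_succ, h1]; exact ⟨1, by simp [dstep, hc]⟩
        · rwa [ph_succ ψ x hq', ← mul_assoc]
      · exact Or.inr ⟨by simp [dstep, hc], hc⟩

lemma run_acc (s : S) (x : ℕ → α) (p : ℕ)
    (h : detRun (dstep ψ L s) (Sum.inl 1) x p ∈ dacc) :
    detRun (dstep ψ L s) (Sum.inl 1) x p = Sum.inr (1, true) ∧ ph ψ x 0 p = s ∧ 0 < p := by
  obtain ⟨g, hg⟩ := h
  rcases run_inv ψ L s x p with ⟨t, h1, -⟩ | ⟨g', b, h1, h2, -, h3⟩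
  · rw [hg] at h1; simp at h1
  · rw [hg] at h1
    simp only [Sum.inr.injEq, Prod.mk.injEq] at h1
    obtain ⟨rfl, rfl⟩ := h1
    obtain ⟨rfl, h4⟩ := h3 rfl
    exact ⟨hg, by rw [← h2, mul_one], h4⟩

lemma dba_sub [Finite S] [TopologicalSpace α] (hG : IsGδ L) (hS : Sat ψ L) (s : S) :
    dbaLang (dstep ψ L s) (Sum.inl 1) dacc ⊆ L := by
  intro x hx
  obtain ⟨e, n, n1, n2, n3⟩ := ramsey (fun i j => ph ψ x i j) _ hx
  have hn : ∀ k, ph ψ x 0 (n k) = s ∧ 0 < n k := fun k => (run_acc ψ L s x _ (n2 k)).2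
  have hacc : Acc ψ L s e := by
    have h01 : n 0 < n 1 := n1 (by omega)
    have h0 := run_acc ψ L s x _ (n2 0)
    have h1 := run_acc ψ L s x _ (n2 1)
    rcases run_on ψ L s x (n 0) 1 true h0.1 (n 1) h01 with ⟨q', a1, a2, a3, a4⟩ | ⟨a1, -⟩
    · rw [one_mul] at a4
      have hq := run_acc ψ L s x _ a3
      have := a4.right ψ L (seg x q' (n 1)) (by
        have := ph_mul ψ x (Nat.zero_le q') a2
        rw [hq.2.1, h1.2.1] at this
        exact this)
      have e2 := ph_mul ψ x a1.le a2
      rw [← n3 0 1 (by omega)]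
      rw [← e2]
      exact this
    · rw [h1.1] at a1; simp at a1
  exact key ψ L hG hS hacc x n ⟨n1, (hn 0).2, (hn 0).1, fun k => n3 k (k + 1) (by omega)⟩

lemma sub_dba [Finite S] (x : ℕ → α) (hx : x ∈ L) :
    ∃ s, x ∈ dbaLang (dstep ψ L s) (Sum.inl 1) dacc := by
  obtain ⟨e, n, n1, -, n3⟩ := ramsey (fun i j => ph ψ x i j) Set.univ Set.infinite_univ
  have hee : e * e = e := by
    have := ph_mul ψ x (n1.monotone (show 0 ≤ 1 by omega)) (n1.monotone (show 1 ≤ 2 by omega))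
    rwa [n3 0 1 (by omega), n3 1 2 (by omega), n3 0 2 (by omega)] at this
  have hpre : ∀ k, ph ψ x 0 (n (k + 1)) = ph ψ x 0 (n 0) * e := by
    intro k
    rw [← ph_mul ψ x (Nat.zero_le (n 0)) (n1.monotone (Nat.zero_le (k + 1))), n3 _ _ (by omega)]
  set s := ph ψ x 0 (n 0) * e with hs
  have hse : s * e = s := by rw [hs, mul_assoc, hee]
  have hpos : ∀ k, 0 < n (k + 1) := fun k => (Nat.zero_le _).trans_lt (n1 (Nat.lt_succ_self k))
  have hT : Typ ψ s e x (fun k => n (k + 1)) :=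
    ⟨fun i j h => n1 (by omega), hpos 0, hpre 0, fun k => n3 _ _ (by omega)⟩
  refine ⟨s, ?_⟩
  rw [dbaLang, Set.mem_setOf_eq, ← Nat.frequently_atTop_iff_infinite, Filter.frequently_atTop]
  intro N
  have hN : N ≤ n (N + 1) := (Nat.le_succ N).trans (n1.le_apply)
  rcases run_inv ψ L s x (n (N + 1)) with ⟨t, -, h2, h3⟩ | ⟨g, b, h1, h2, ⟨v, hv⟩, h3⟩
  · exact absurd (h2.trans (hpre N)) (h3 (hpos N))
  · rcases run_on ψ L s x _ g b h1 (n (N + 2)) (n1 (by omega)) with ⟨q', a1, a2, a3, a4⟩ | ⟨-, a2⟩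
    · exact ⟨q', by omega, a3⟩
    · refine absurd ?_ a2
      rw [n3 _ _ (by omega)]
      refine ⟨v, e, [], by simp [pw, ← hv], ?_, hse, by simp [pw], hee, x, hx, _, hT⟩
      rw [hv, h2, hpre]

lemma run_pi {ι K : Type*} (δ : ι → K → α → K) (q : K) (x : ℕ → α) (n : ℕ) (i : ι) :
    detRun (fun (p : ι → K) a i => δ i (p i) a) (fun _ => q) x n i = detRun (δ i) q x n := by
  induction n with
  | zero => rfl
  | succ n ih =>
    change δ i (detRun (fun (p : ι → K) a i => δ i (p i) a) (fun _ => q) x n i) (x n) = _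
    rw [ih]; rfl

theorem core {S : Type} [Monoid S] [Finite S] [TopologicalSpace α] (ψ : α → S) (hG : IsGδ L) (hS : Sat ψ L) :
    ∃ (K : Type) (_ : Fintype K) (δ : K → α → K) (q₀ : K) (F : Set K), L = dbaLang δ q₀ F := by
  refine ⟨S → S ⊕ (S × Bool), Fintype.ofFinite _, fun p a s => dstep ψ L s (p s) a,
    fun _ => Sum.inl 1, {p | ∃ s, p s ∈ dacc}, ?_⟩
  have : dbaLang (fun p a s => dstep ψ L s (p s) a) (fun _ : S => (Sum.inl 1 : S ⊕ (S × Bool)))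
      {p | ∃ s, p s ∈ dacc} = ⋃ s, dbaLang (dstep ψ L s) (Sum.inl 1) dacc := by
    ext x
    simp only [dbaLang, Set.mem_setOf_eq, Set.mem_iUnion, run_pi]
    rw [Set.setOf_exists, ← not_iff_not]
    simp only [Set.not_infinite, not_exists]
    exact ⟨fun h s => h.subset fun n hn => Set.mem_iUnion.2 ⟨s, hn⟩, fun h => Set.finite_iUnion h⟩
  rw [this]
  apply Set.Subset.antisymm
  · intro x hx
    exact Set.mem_iUnion.2 (sub_dba ψ L x hx)
  · exact Set.iUnion_subset (dba_sub ψ L hG hS)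

end core

section nba
variable {α K : Type*} (δ : K → α → Set K) (F : Set K)

/-- One letter acting on sets of states with a flag. -/
def letter (a : α) : (Function.End (Set (K × Bool)))ᵐᵒᵖ :=
  MulOpposite.op fun A => {q | ∃ p ∈ A, q.1 ∈ δ p.1 a ∧ (q.2 = true → p.2 = true ∨ q.1 ∈ F)}

/-- Finite paths with a flag. -/
def Path (x : ℕ → α) (i j : ℕ) (p q : K) (c : Bool) : Prop :=
  ∃ r : ℕ → K, r i = p ∧ r j = q ∧ (∀ k, i ≤ k → k < j → r (k + 1) ∈ δ (r k) (x k)) ∧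
    (c = true → ∃ k, i < k ∧ k ≤ j ∧ r k ∈ F)

lemma path_iff (x : ℕ → α) (i j : ℕ) (h : i ≤ j) (p q : K) (c : Bool) :
    Path δ F x i j p q c ↔ (q, c) ∈ (ph (letter δ F) x i j).unop {((p, false) : K × Bool)} := by
  induction j, h using Nat.le_induction generalizing q c with
  | base =>
    rw [ph_self]
    change _ ↔ (q, c) ∈ ({(p, false)} : Set (K × Bool))
    simp only [Set.mem_singleton_iff, Prod.mk.injEq]
    constructor
    · rintro ⟨r, rfl, rfl, -, h⟩
      refine ⟨rfl, ?_⟩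
      by_contra hc
      obtain ⟨k, h1, h2, -⟩ := h (by simpa using hc)
      omega
    · rintro ⟨rfl, rfl⟩
      exact ⟨fun _ => q, rfl, rfl, fun k h1 h2 => by omega, by simp⟩
  | succ j hj ih =>
    rw [ph_succ _ x hj]
    change _ ↔ ∃ p' ∈ (ph (letter δ F) x i j).unop {((p, false) : K × Bool)},
      q ∈ δ p'.1 (x j) ∧ (c = true → p'.2 = true ∨ q ∈ F)
    constructor
    · rintro ⟨r, h1, rfl, h3, h4⟩
      by_cases hc : c = true ∧ r (j + 1) ∉ F
      · refine ⟨(r j, true), (ih _ _).1 ⟨r, h1, rfl, fun k a b => h3 k a (by omega), fun _ => ?_⟩,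
          h3 j hj (by omega), fun _ => Or.inl rfl⟩
        obtain ⟨k, k1, k2, k3⟩ := h4 hc.1
        refine ⟨k, k1, ?_, k3⟩
        rcases Nat.lt_or_ge j k with hk | hk
        · have : k = j + 1 := by omega
          subst this
          exact absurd k3 hc.2
        · exact hk
      · refine ⟨(r j, false),
          (ih _ _).1 ⟨r, h1, rfl, fun k a b => h3 k a (by omega), by simp⟩,
          h3 j hj (by omega), fun h => Or.inr ?_⟩
        by_contra h'
        exact hc ⟨h, h'⟩
    · rintro ⟨⟨p', b⟩, hp, h1, h2⟩
      obtain ⟨r, r1, r2, r3, r4⟩ := (ih _ _).2 hp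
      simp only at h1 h2
      refine ⟨fun k => if k ≤ j then r k else q, by simp [hj, r1], by simp, ?_, ?_⟩
      · intro k k1 k2
        rcases Nat.lt_or_ge k j with hk | hk
        · have e1 : k + 1 ≤ j := hk
          simp only [e1, hk.le, if_true]
          exact r3 k k1 hk
        · have : k = j := by omega
          subst this
          simpa [r2] using h1
      · intro hc
        rcases h2 hc with hb | hq
        · obtain ⟨k, k1, k2, k3⟩ := r4 hb
          exact ⟨k, k1, by omega, by simpa [k2] using k3⟩
        · exact ⟨j + 1, by omega, le_rfl, by simpa using hq⟩

lemma glue (m : ℕ → ℕ) (hm : StrictMono m) (h0 : m 0 = 0) (p : ℕ → ℕ → K)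
    (hp : ∀ k, p k (m (k + 1)) = p (k + 1) (m (k + 1))) :
    ∃ r : ℕ → K, ∀ k i, m k ≤ i → i ≤ m (k + 1) → r i = p k i := by
  have hex : ∀ i, ∃ k, i < m (k + 1) := fun i => ⟨i, hm.le_apply (x := i + 1)⟩
  classical
  have huniq : ∀ k i, m k ≤ i → i < m (k + 1) → Nat.find (hex i) = k := by
    intro k i h1 h2
    apply le_antisymm (Nat.find_min' (hex i) h2)
    by_contra hlt
    have := Nat.find_spec (hex i)
    have h3 : m (Nat.find (hex i) + 1) ≤ m k := hm.monotone (by omega)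
    omega
  refine ⟨fun i => p (Nat.find (hex i)) i, fun k i h1 h2 => ?_⟩
  rcases h2.lt_or_eq with h2 | rfl
  · simp only [huniq k i h1 h2]
  · simp only [huniq (k + 1) _ le_rfl (hm (by omega)), hp]

lemma block (m : ℕ → ℕ) (hm : StrictMono m) (h0 : m 0 = 0) (i : ℕ) :
    ∃ k, m k ≤ i ∧ i < m (k + 1) := by
  classical
  have hex : ∃ k, i < m (k + 1) := ⟨i, hm.le_apply (x := i + 1)⟩
  refine ⟨Nat.find hex, ?_, Nat.find_spec hex⟩
  rcases Nat.eq_zero_or_pos (Nat.find hex) with h | h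
  · rw [h, h0]; exact Nat.zero_le i
  · have := Nat.find_min hex (m := Nat.find hex - 1) (by omega)
    rw [Nat.sub_add_cancel h] at this
    omega

lemma nba_sat0 (q₀ : K) (x y : ℕ → α) (n m : ℕ → ℕ) (hn : StrictMono n) (hm : StrictMono m)
    (hn0 : n 0 = 0) (hm0 : m 0 = 0)
    (h : ∀ k, ph (letter δ F) x (n k) (n (k + 1)) = ph (letter δ F) y (m k) (m (k + 1)))
    (hx : x ∈ nbaLang δ q₀ F) : y ∈ nbaLang δ q₀ F := by
  obtain ⟨r, r0, r1, r2⟩ := hx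
  classical
  have hpath : ∀ k, Path δ F y (m k) (m (k + 1)) (r (n k)) (r (n (k + 1)))
      (decide (∃ i, n k < i ∧ i ≤ n (k + 1) ∧ r i ∈ F)) := by
    intro k
    rw [path_iff δ F y _ _ (hm.monotone (Nat.le_succ k)), ← h,
      ← path_iff δ F x _ _ (hn.monotone (Nat.le_succ k))]
    exact ⟨r, rfl, rfl, fun i _ _ => r1 i, by simp⟩
  choose p p1 p2 p3 p4 using hpath
  obtain ⟨r', hr'⟩ := glue m hm hm0 p (fun k => by rw [p2, p1])
  refine ⟨r', ?_, ?_, ?_⟩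
  · have := hr' 0 0 (by omega) (by omega)
    rw [this]
    have := p1 0
    rw [hm0, hn0] at this
    rw [this, r0]
  · intro i
    obtain ⟨k, k1, k2⟩ := block m hm hm0 i
    rw [hr' k i k1 k2.le, hr' k (i + 1) (by omega) k2]
    exact p3 k i k1 k2
  · rw [← Nat.frequently_atTop_iff_infinite, Filter.frequently_atTop] at r2 ⊢
    intro N
    obtain ⟨i, hi, hiF⟩ := r2 (n N + 1)
    obtain ⟨k, k1, k2⟩ := block n hn hn0 (i - 1)
    have hk : N ≤ k := by
      by_contra hlt
      have := hn.monotone (show k + 1 ≤ N by omega)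
      omega
    obtain ⟨j, j1, j2, j3⟩ := p4 k (by
      simp only [decide_eq_true_eq]
      exact ⟨i, by omega, by omega, hiF⟩)
    refine ⟨j, ?_, ?_⟩
    · have := hm.le_apply (x := k)
      omega
    · rw [hr' k j j1.le j2]; exact j3

lemma nba_sat (q₀ : K) : Sat (letter δ F) (nbaLang δ q₀ F) := by
  intro s e x y n m ⟨n1, n2, n3, n4⟩ ⟨m1, m2, m3, m4⟩ hx
  have mono : ∀ n : ℕ → ℕ, StrictMono n → 0 < n 0 →
      StrictMono (fun k => Nat.casesOn k 0 n : ℕ → ℕ) := by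
    intro n hn h0
    apply strictMono_nat_of_lt_succ
    intro k
    cases k with
    | zero => exact h0
    | succ k => exact hn (Nat.lt_succ_self k)
  refine nba_sat0 δ F q₀ x y _ _ (mono n n1 n2) (mono m m1 m2) rfl rfl ?_ hx
  intro k
  cases k with
  | zero => exact n3.trans m3.symm
  | succ k => exact (n4 k).trans (m4 k).symm

end nba

lemma continuous_detRun {α K : Type*} [TopologicalSpace α] [DiscreteTopology α]
    [TopologicalSpace K] [DiscreteTopology K] (δ : K → α → K) (q₀ : K) (n : ℕ) :
    Continuous fun x : ℕ → α => detRun δ q₀ x n := by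
  induction n with
  | zero => exact continuous_const
  | succ n ih =>
    have h1 : Continuous fun p : K × α => δ p.1 p.2 := continuous_of_discreteTopology
    exact h1.comp (ih.prodMk (continuous_apply n))

lemma dba_Gdelta {α K : Type*} [TopologicalSpace α] [DiscreteTopology α]
    (δ : K → α → K) (q₀ : K) (F : Set K) : IsGδ (dbaLang δ q₀ F) := by
  let _ : TopologicalSpace K := ⊥
  have : DiscreteTopology K := ⟨rfl⟩
  have : dbaLang δ q₀ F = ⋂ N : ℕ, ⋃ n ≥ N, {x | detRun δ q₀ x n ∈ F} := by
    ext x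
    simp only [dbaLang, Set.mem_setOf_eq, ← Nat.frequently_atTop_iff_infinite,
      Filter.frequently_atTop, Set.mem_iInter, Set.mem_iUnion, exists_prop]
  rw [this]
  refine IsGδ.iInter_of_isOpen fun N => isOpen_biUnion fun n _ => ?_
  exact (isOpen_discrete F).preimage (continuous_detRun δ q₀ n)

end LW

/-- Landweber: an ω-regular language `L ⊆ α^ω` (accepted by some
nondeterministic Büchi automaton with finite state set) is a `Π⁰₂` (Gδ) subset of the
Cantor space `α^ω` iff it is accepted by some deterministic Büchi automaton with finite
state set. -/
theorem omega_regular_isGdelta_iff_deterministic_buchi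
    {α : Type*} [Fintype α] [Nonempty α] [TopologicalSpace α] [DiscreteTopology α]
    (L : Set (ℕ → α))
    (hreg : ∃ (K : Type) (_ : Fintype K) (δ : K → α → Set K) (q₀ : K) (F : Set K),
      L = nbaLang δ q₀ F) :
    IsGδ L ↔
      ∃ (K : Type) (_ : Fintype K) (δ : K → α → K) (q₀ : K) (F : Set K),
        L = dbaLang δ q₀ F := by
  constructor
  · intro hG
    obtain ⟨K, _, δ, q₀, F, rfl⟩ := hreg
    have : Finite (Function.End (Set (K × Bool))) :=
      inferInstanceAs (Finite (Set (K × Bool) → Set (K × Bool)))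
    have : Finite (Function.End (Set (K × Bool)))ᵐᵒᵖ :=
      Finite.of_equiv _ MulOpposite.opEquiv
    exact LW.core _ (LW.letter δ F) hG (LW.nba_sat δ F q₀)
  · rintro ⟨K, _, δ, q₀, F, rfl⟩
    exact LW.dba_Gdelta δ q₀ F
end

section
/- Let Σ and Γ be nonempty finite alphabets and let f : Σ^ω → Γ^ω be an ω-rational function, i.e. a total function whose graph {(x, f(x)) : x ∈ Σ^ω} equals the infinitary rational relation R(𝒯) ⊆ Σ^ω × Γ^ω accepted by some 2-tape Büchi automaton 𝒯. Then there exists a dense Π⁰₂ (Gδ) subset G of Σ^ω that is accepted by a deterministic Büchi automaton with finite state set, such that the restriction of f to G is continuous. -/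
/-- The concatenation `u₁u₂…u_n` of the first `n` finite words of the sequence `us`. -/
def partialConcat {α : Type*} (us : ℕ → List α) (n : ℕ) : List α :=
  ((List.range n).map us).flatten

/-- `infConcatEq us x` says that the infinite concatenation `u₁u₂u₃…` of the sequence
of finite words `us` is the ω-word `x`: every partial concatenation is a prefix of `x`,
and the lengths of the partial concatenations are unbounded (so the concatenation is
indeed infinite). -/
def infConcatEq {α : Type*} (us : ℕ → List α) (x : ℕ → α) : Prop :=
  (∀ n, (List.ofFn fun i : Fin (partialConcat us n).length => x i) = partialConcat us n)
    ∧ ∀ k : ℕ, ∃ n, k ≤ (partialConcat us n).length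

/-- The infinitary rational relation `R(𝒯) ⊆ α^ω × β^ω` accepted by the 2-tape Büchi
automaton `𝒯 = (K, α, β, Δ, q₀, F)`: the pairs `(x, y)` such that `x` and `y` are the
input and output words of some successful computation of `𝒯`, i.e. of some infinite
sequence of consecutive transitions starting in `q₀` in which some accepting state
occurs infinitely often. -/
def twoTapeBuchiRel {α β K : Type*} (Δ : Set (K × List α × List β × K)) (q₀ : K)
    (F : Set K) : Set ((ℕ → α) × (ℕ → β)) :=
  {p | ∃ (qs : ℕ → K) (us : ℕ → List α) (vs : ℕ → List β),
    qs 0 = q₀ ∧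
    (∀ n, (qs n, us n, vs n, qs (n + 1)) ∈ Δ) ∧
    (∃ qf ∈ F, {n : ℕ | qs n = qf}.Infinite) ∧
    infConcatEq us p.1 ∧ infConcatEq vs p.2}

section Words

/-- the factor `x[m, n)` of an infinite word -/
def seg {α : Type*} (x : ℕ → α) (m n : ℕ) : List α := (List.range' m (n - m)).map x

lemma seg_length {α : Type*} (x : ℕ → α) (m n : ℕ) : (seg x m n).length = n - m := by
  simp [seg]

lemma seg_append {α : Type*} (x : ℕ → α) {a b c : ℕ} (h : a ≤ b) (h' : b ≤ c) :
    seg x a b ++ seg x b c = seg x a c := by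
  unfold seg
  rw [← List.map_append]
  congr 1
  have h1 : c - a = (b - a) + (c - b) := by omega
  rw [h1, List.range'_append_1.symm]
  congr 2
  omega

lemma seg_self {α : Type*} (x : ℕ → α) (a : ℕ) : seg x a a = [] := by simp [seg]

lemma seg_succ {α : Type*} (x : ℕ → α) (a : ℕ) : seg x a (a+1) = [x a] := by simp [seg]

lemma seg_getElem {α : Type*} (x : ℕ → α) (a b i : ℕ) (h : i < (seg x a b).length) :
    (seg x a b)[i] = x (a + i) := by simp [seg]

lemma seg_congr {α : Type*} {x y : ℕ → α} {a b : ℕ} (h : ∀ i, i < b → x i = y i) :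
    seg x a b = seg y a b := by
  apply List.ext_getElem
  · simp [seg_length]
  · intro i h1 h2
    rw [seg_getElem, seg_getElem]
    rw [seg_length] at h1
    exact h _ (by omega)

lemma ofFn_eq_seg {α : Type*} (x : ℕ → α) (n : ℕ) :
    (List.ofFn fun i : Fin n => x i) = seg x 0 n := by
  apply List.ext_getElem
  · simp [seg_length]
  · intro i h1 h2
    rw [seg_getElem]
    simp

lemma pc_succ {α : Type*} (us : ℕ → List α) (n : ℕ) :
    partialConcat us (n+1) = partialConcat us n ++ us n := by
  simp [partialConcat, List.range_succ]

lemma pc_zero {α : Type*} (us : ℕ → List α) : partialConcat us 0 = [] := by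
  simp [partialConcat]

lemma pc_prefix_mono {α : Type*} (us : ℕ → List α) {m n : ℕ} (h : m ≤ n) :
    partialConcat us m <+: partialConcat us n := by
  induction n, h using Nat.le_induction with
  | base => exact List.prefix_rfl
  | succ n _ ih => rw [pc_succ]; exact ih.trans (List.prefix_append _ _)

lemma pc_len_mono {α : Type*} (us : ℕ → List α) {m n : ℕ} (h : m ≤ n) :
    (partialConcat us m).length ≤ (partialConcat us n).length := (pc_prefix_mono us h).length_le

lemma infConcatEq_iff {α : Type*} (us : ℕ → List α) (x : ℕ → α) :
    infConcatEq us x ↔ (∀ n, partialConcat us n = seg x 0 (partialConcat us n).length)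
      ∧ ∀ k : ℕ, ∃ n, k ≤ (partialConcat us n).length := by
  unfold infConcatEq
  constructor
  · rintro ⟨h, h'⟩
    refine ⟨fun n => ?_, h'⟩
    rw [← ofFn_eq_seg]; exact (h n).symm
  · rintro ⟨h, h'⟩
    refine ⟨fun n => ?_, h'⟩
    rw [ofFn_eq_seg]; exact (h n).symm

lemma eq_seg_of_prefix_seg {α : Type*} {l : List α} {x : ℕ → α} {n : ℕ} (h : l <+: seg x 0 n) :
    l = seg x 0 l.length := by
  apply List.ext_getElem
  · simp [seg_length]
  · intro i h1 h2
    rw [seg_getElem, h.getElem h1, seg_getElem]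

lemma prefix_seg {α : Type*} (x : ℕ → α) {m n : ℕ} (h : m ≤ n) : seg x 0 m <+: seg x 0 n :=
  ⟨seg x m n, seg_append x (Nat.zero_le _) h⟩

lemma exists_infConcat {α : Type*} (us : ℕ → List α)
    (h : ∀ k : ℕ, ∃ n, k ≤ (partialConcat us n).length) : ∃ x, infConcatEq us x := by
  choose N hN using h
  refine ⟨fun i => (partialConcat us (N (i+1)))[i]'(hN (i+1)), ?_⟩
  rw [infConcatEq_iff]
  refine ⟨fun n => ?_, fun k => ⟨N k, hN k⟩⟩
  apply List.ext_getElem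
  · simp [seg_length]
  · intro i h1 h2
    rw [seg_getElem]
    simp only [zero_add]
    rcases le_total n (N (i+1)) with hle | hle
    · exact (pc_prefix_mono us hle).getElem h1
    · exact ((pc_prefix_mono us hle).getElem (hN (i+1))).symm

lemma pc_unbounded {α : Type*} (us : ℕ → List α) (h : ∀ m, ∃ n, m ≤ n ∧ us n ≠ []) (k : ℕ) :
    ∃ n, k ≤ (partialConcat us n).length := by
  induction k with
  | zero => exact ⟨0, Nat.zero_le _⟩
  | succ k ih =>
    obtain ⟨n, hn⟩ := ih
    obtain ⟨m, hm, hne⟩ := h n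
    refine ⟨m+1, ?_⟩
    rw [pc_succ, List.length_append]
    have := pc_len_mono us hm
    have := List.length_pos_iff.2 hne
    omega

lemma nonempty_of_unbounded {α : Type*} (us : ℕ → List α)
    (h : ∀ k : ℕ, ∃ n, k ≤ (partialConcat us n).length) (m : ℕ) : ∃ n, m ≤ n ∧ us n ≠ [] := by
  by_contra hcon
  push Not at hcon
  have key : ∀ n, m ≤ n → (partialConcat us n).length = (partialConcat us m).length := by
    intro n hn
    induction n, hn using Nat.le_induction with
    | base => rfl
    | succ n hmn ih => rw [pc_succ, hcon n hmn, List.append_nil, ih]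
  obtain ⟨n, hn⟩ := h ((partialConcat us m).length + 1)
  rcases le_total m n with h1 | h1
  · have := key n h1; omega
  · have := pc_len_mono us h1; omega

end Words

section Monoids

lemma exists_idem_pow {M : Type*} [Monoid M] [Finite M] (a : M) :
    ∃ k, 1 ≤ k ∧ a ^ k * a ^ k = a ^ k := by
  obtain ⟨m, n, hmn, h⟩ : ∃ m n : ℕ, m < n ∧ a ^ m = a ^ n := by
    obtain ⟨m, n, hne, h⟩ := Finite.exists_ne_map_eq_of_infinite (fun n : ℕ => a ^ n)
    rcases lt_or_gt_of_ne hne with h1 | h1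
    · exact ⟨m, n, h1, h⟩
    · exact ⟨n, m, h1, h.symm⟩
  obtain ⟨d, rfl⟩ := Nat.exists_eq_add_of_lt hmn
  -- a^m = a^(m + (d+1))
  have h1 : ∀ j, a ^ m * a ^ (j * (d+1)) = a ^ m := by
    intro j
    induction j with
    | zero => simp
    | succ j ih =>
      rw [Nat.succ_mul, pow_add, ← mul_assoc, ih, ← pow_add]
      exact h.symm
  refine ⟨(m+1) * (d+1), Nat.mul_pos (Nat.succ_pos _) (Nat.succ_pos _), ?_⟩
  have h2 : m ≤ (m+1)*(d+1) := by nlinarith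
  obtain ⟨c, hc⟩ := Nat.exists_eq_add_of_le' h2
  nth_rewrite 1 [hc]
  rw [pow_add, mul_assoc, h1, ← pow_add, ← hc]

lemma exists_min_idem (M : Type*) [Monoid M] [Finite M] :
    ∃ e : M, e * e = e ∧ ∀ a, e * a = a → a * e = a → ∃ k, 1 ≤ k ∧ a ^ k = e := by
  classical
  have hne : {e : M | e * e = e}.Nonempty := ⟨1, by simp⟩
  obtain ⟨e, he, hmin⟩ := Set.exists_min_image {e : M | e * e = e}
    (fun e => {a : M | e * a = a ∧ a * e = a}.ncard) (Set.toFinite _) hne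
  refine ⟨e, he, fun a h1 h2 => ?_⟩
  obtain ⟨k, hk, hid⟩ := exists_idem_pow a
  refine ⟨k, hk, ?_⟩
  have e1 : e * a ^ k = a ^ k := by
    obtain ⟨j, rfl⟩ := Nat.exists_eq_add_of_le' hk
    rw [pow_succ', ← mul_assoc, h1]
  have e2 : a ^ k * e = a ^ k := by
    obtain ⟨j, rfl⟩ := Nat.exists_eq_add_of_le' hk
    rw [pow_succ, mul_assoc, h2]
  have hsub : {b : M | a^k * b = b ∧ b * a^k = b} ⊆ {b : M | e * b = b ∧ b * e = b} := by
    rintro b ⟨hb1, hb2⟩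
    refine ⟨?_, ?_⟩
    · rw [← hb1, ← mul_assoc, e1]
    · rw [← hb2, mul_assoc, e2]
  have heq := Set.eq_of_subset_of_ncard_le hsub (hmin (a^k) hid) (Set.toFinite _)
  have : e ∈ {b : M | a^k * b = b ∧ b * a^k = b} := by rw [heq]; exact ⟨he, he⟩
  exact e2.symm.trans this.1

/-- If `e` is a minimal idempotent, the elements of the local monoid form a group. -/
lemma link {M : Type*} [Monoid M] {e p p' : M}
    (hmin : ∀ a, e * a = a → a * e = a → ∃ k, 1 ≤ k ∧ a ^ k = e)
    (h1 : e * p = p) (h2 : p * e = p) (h1' : e * p' = p') (h2' : p' * e = p') :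
    ∃ c d, p * c = p' ∧ c * d = e ∧ d * c = e := by
  obtain ⟨k, hk, hp⟩ := hmin p h1 h2
  obtain ⟨k', hk', hp'⟩ := hmin p' h1' h2'
  obtain ⟨j, rfl⟩ := Nat.exists_eq_add_of_le' hk
  obtain ⟨j', rfl⟩ := Nat.exists_eq_add_of_le' hk'
  refine ⟨p^j * p', p'^j' * p, ?_, ?_, ?_⟩
  · rw [← mul_assoc, ← pow_succ', hp, h1']
  · rw [mul_assoc, ← mul_assoc p', ← pow_succ', hp', h1, ← pow_succ, hp]
  · rw [mul_assoc, ← mul_assoc p, ← pow_succ', hp, h1', ← pow_succ, hp']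

lemma cancel_left {M : Type*} [Monoid M] {e p h : M}
    (hmin : ∀ a, e * a = a → a * e = a → ∃ k, 1 ≤ k ∧ a ^ k = e)
    (h1 : e * p = p) (h2 : p * e = p) (hh : e * h = h) (hph : p * h = p) : h = e := by
  obtain ⟨k, hk, hp⟩ := hmin p h1 h2
  obtain ⟨j, rfl⟩ := Nat.exists_eq_add_of_le' hk
  rw [← hh, ← hp, pow_succ, mul_assoc, hph]

end Monoids

section Paths
variable {α β K : Type*}

/-- `l` is a path of consecutive transitions -/
def IsPath (Δ : Set (K × List α × List β × K)) : K → List (K × List α × List β × K) → K → Prop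
  | q, [], q' => q = q'
  | q, t :: l, q' => t ∈ Δ ∧ t.1 = q ∧ IsPath Δ t.2.2.2 l q'

def inp (l : List (K × List α × List β × K)) : List α := (l.map (fun t => t.2.1)).flatten
def outp (l : List (K × List α × List β × K)) : List β := (l.map (fun t => t.2.2.1)).flatten

lemma inp_append (l l' : List (K × List α × List β × K)) : inp (l ++ l') = inp l ++ inp l' := by
  simp [inp]
lemma outp_append (l l' : List (K × List α × List β × K)) :
    outp (l ++ l') = outp l ++ outp l' := by
  simp [outp]
lemma inp_cons (t) (l : List (K × List α × List β × K)) : inp (t :: l) = t.2.1 ++ inp l := by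
  simp [inp]

lemma IsPath.append {Δ : Set (K × List α × List β × K)} {q q' q'' l l'} (h : IsPath Δ q l q')
    (h' : IsPath Δ q' l' q'') : IsPath Δ q (l ++ l') q'' := by
  induction l generalizing q with
  | nil => cases h; exact h'
  | cons t l ih => exact ⟨h.1, h.2.1, ih h.2.2⟩

lemma IsPath.mem {Δ : Set (K × List α × List β × K)} {q q' l} (h : IsPath Δ q l q') :
    ∀ t ∈ l, t ∈ Δ := by
  induction l generalizing q with
  | nil => simp
  | cons t l ih =>
    intro s hs
    rcases List.mem_cons.1 hs with rfl | hs
    · exact h.1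
    · exact ih h.2.2 s hs

lemma IsPath.start {Δ : Set (K × List α × List β × K)} {q q' l} (h : IsPath Δ q l q')
    (h0 : 0 < l.length) : l[0].1 = q := by
  cases l with
  | nil => simp at h0
  | cons t l => exact h.2.1

lemma IsPath.chain {Δ : Set (K × List α × List β × K)} {q q' l} (h : IsPath Δ q l q') (i : ℕ)
    (hi : i + 1 < l.length) : (l[i]).2.2.2 = (l[i+1]).1 := by
  induction l generalizing q i with
  | nil => simp at hi
  | cons t l ih =>
    cases i with
    | zero =>
      have := h.2.2.start (by simpa using hi)
      simpa using this.symm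
    | succ i =>
      have := ih h.2.2 i (by simpa using hi)
      simpa using this

lemma IsPath.split {Δ : Set (K × List α × List β × K)} {M : ℕ}
    (hM : ∀ t ∈ Δ, t.2.1.length ≤ M) {q q' l} (h : IsPath Δ q l q') {r u v r' : List α}
    (hr : r.length ≤ M) (he : r ++ inp l = u ++ v ++ r') :
    ∃ l1 l2 q1 r1, r1.length ≤ M ∧ l = l1 ++ l2 ∧ IsPath Δ q l1 q1 ∧ IsPath Δ q1 l2 q' ∧
      r ++ inp l1 = u ++ r1 ∧ r1 ++ inp l2 = v ++ r' := by
  induction l generalizing q r u with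
  | nil =>
    have e : r = u ++ (v ++ r') := by simpa [inp] using he
    refine ⟨[], [], q, v ++ r', ?_, rfl, rfl, h, ?_, ?_⟩
    · rw [e] at hr; simp at hr ⊢; omega
    · simpa [inp] using e
    · simp [inp]
  | cons t l ih =>
    rw [List.append_assoc] at he
    rcases List.append_eq_append_iff.1 he with ⟨a, h1, h2⟩ | ⟨a, h1, h2⟩
    · rw [inp_cons] at h2
      obtain ⟨l1, l2, q1, r1, hr1, rfl, hp1, hp2, e1, e2⟩ := ih h.2.2 (r := t.2.1) (u := a)
        (hM t h.1) (by rw [h2, List.append_assoc])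
      refine ⟨t :: l1, l2, q1, r1, hr1, rfl, ⟨h.1, h.2.1, hp1⟩, hp2, ?_, e2⟩
      rw [inp_cons, e1, h1, List.append_assoc]
    · refine ⟨[], t :: l, q, a, ?_, rfl, rfl, h, ?_, h2.symm⟩
      · rw [h1] at hr; simp at hr; omega
      · simpa [inp] using h1

def flag (F : Set K) (l : List (K × List α × List β × K)) : Prop × Prop :=
  (∃ t ∈ l, t.1 ∈ F, outp l ≠ [])

lemma flag_append (F : Set K) (l l' : List (K × List α × List β × K)) :
    flag F (l ++ l') = flag F l ⊔ flag F l' := by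
  unfold flag
  ext
  · simp [or_and_right, exists_or]
  · simp only [outp_append, Prod.snd_sup, sup_Prop_eq, ne_eq, List.append_eq_nil_iff]
    tauto

abbrev Cfg (α K : Type*) (M : ℕ) := K × {r : List α // r.length ≤ M}

/-- the behaviour of a word -/
def prof (Δ : Set (K × List α × List β × K)) (F : Set K) (M : ℕ) (w : List α) :
    Set (Cfg α K M × (Prop × Prop) × Cfg α K M) :=
  {z | ∃ l, IsPath Δ z.1.1 l z.2.2.1 ∧ z.1.2.1 ++ inp l = w ++ z.2.2.2.1 ∧ flag F l = z.2.1}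

def comp {C : Type*} (S T : Set (C × (Prop × Prop) × C)) : Set (C × (Prop × Prop) × C) :=
  {z | ∃ c f g, (z.1, f, c) ∈ S ∧ (c, g, z.2.2) ∈ T ∧ z.2.1 = f ⊔ g}

lemma prof_append {Δ : Set (K × List α × List β × K)} (F : Set K) {M : ℕ}
    (hM : ∀ t ∈ Δ, t.2.1.length ≤ M) (u v : List α) :
    prof Δ F M (u ++ v) = comp (prof Δ F M u) (prof Δ F M v) := by
  ext ⟨⟨q, r, hr⟩, f, ⟨q', r', hr'⟩⟩
  constructor
  · rintro ⟨l, hp, he, rfl⟩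
    obtain ⟨l1, l2, q1, r1, hr1, rfl, hp1, hp2, e1, e2⟩ := hp.split hM hr he
    exact ⟨(q1, ⟨r1, hr1⟩), flag F l1, flag F l2, ⟨l1, hp1, e1, rfl⟩, ⟨l2, hp2, e2, rfl⟩,
      flag_append _ _ _⟩
  · rintro ⟨⟨q1, r1, hr1⟩, f1, f2, ⟨l1, hp1, e1, rfl⟩, ⟨l2, hp2, e2, rfl⟩, hf⟩
    refine ⟨l1 ++ l2, hp1.append hp2, ?_, ?_⟩
    · simp only at e1 e2 ⊢
      rw [inp_append, ← List.append_assoc, e1, List.append_assoc, e2, List.append_assoc]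
    · rw [flag_append]; exact hf.symm

/-- the syntactic congruence -/
def profCon (Δ : Set (K × List α × List β × K)) (F : Set K) {M : ℕ}
    (hM : ∀ t ∈ Δ, t.2.1.length ≤ M) : Con (FreeMonoid α) where
  r u v := prof Δ F M u.toList = prof Δ F M v.toList
  iseqv := ⟨fun _ => rfl, fun h => h.symm, fun h h' => h.trans h'⟩
  mul' := by
    intro a b c d h h'
    rw [FreeMonoid.toList_mul, FreeMonoid.toList_mul, prof_append F hM, prof_append F hM, h, h']

lemma profCon_finite [Finite α] [Finite K] (Δ : Set (K × List α × List β × K)) (F : Set K) {M : ℕ}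
    (hM : ∀ t ∈ Δ, t.2.1.length ≤ M) : Finite (profCon Δ F hM).Quotient := by
  have : Finite {r : List α // r.length ≤ M} := List.finite_length_le α M
  have : Finite (Set (Cfg α K M × (Prop × Prop) × Cfg α K M)) := inferInstance
  let g : (profCon Δ F hM).Quotient → Set (Cfg α K M × (Prop × Prop) × Cfg α K M) :=
    fun s => Con.liftOn s (fun u => prof Δ F M u.toList) (fun a b h => h)
  refine Finite.of_injective g ?_
  intro a b
  induction a using Con.induction_on with | _ a
  induction b using Con.induction_on with | _ b
  intro h
  exact (Con.eq _).2 h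

end Paths

section Runs
variable {α β K : Type*}

lemma inp_seg_zero (t : ℕ → K × List α × List β × K) (n : ℕ) :
    inp (seg t 0 n) = partialConcat (fun i => (t i).2.1) n := by
  induction n with
  | zero => simp [seg, inp, partialConcat]
  | succ n ih =>
    rw [← seg_append t (Nat.zero_le n) (Nat.le_succ n), inp_append, ih, pc_succ, seg_succ]
    simp [inp]

lemma outp_seg_zero (t : ℕ → K × List α × List β × K) (n : ℕ) :
    outp (seg t 0 n) = partialConcat (fun i => (t i).2.2.1) n := by
  induction n with
  | zero => simp [seg, outp, partialConcat]
  | succ n ih =>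
    rw [← seg_append t (Nat.zero_le n) (Nat.le_succ n), outp_append, ih, pc_succ, seg_succ]
    simp [outp]

lemma isPath_seg {Δ : Set (K × List α × List β × K)} {t : ℕ → K × List α × List β × K}
    (hΔ : ∀ n, t n ∈ Δ) (ht : ∀ n, (t n).2.2.2 = (t (n+1)).1) {a b : ℕ} (h : a ≤ b) :
    IsPath Δ (t a).1 (seg t a b) (t b).1 := by
  induction b, h using Nat.le_induction with
  | base => rw [seg_self]; rfl
  | succ n hn ih =>
    rw [← seg_append t hn (Nat.le_succ n), seg_succ]
    exact ih.append ⟨hΔ n, rfl, ht n⟩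

lemma inp_seg {t : ℕ → K × List α × List β × K} {x : ℕ → α}
    (hx : infConcatEq (fun i => (t i).2.1) x) {a b : ℕ} (h : a ≤ b) :
    inp (seg t a b) = seg x (partialConcat (fun i => (t i).2.1) a).length
      (partialConcat (fun i => (t i).2.1) b).length := by
  rw [infConcatEq_iff] at hx
  have h1 := inp_seg_zero t b
  rw [← seg_append t (Nat.zero_le a) h, inp_append, inp_seg_zero, hx.1 b,
    ← seg_append x (Nat.zero_le _) (pc_len_mono _ h), ← hx.1 a] at h1
  exact List.append_cancel_left h1

lemma mem_seg {γ : Type*} (t : ℕ → γ) {a b n : ℕ} (h : a ≤ n) (h' : n < b) : t n ∈ seg t a b := by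
  unfold seg
  apply List.mem_map_of_mem
  simp; omega

lemma exists_block {N : ℕ → ℕ} (hN : Monotone N) (hu : ∀ n, ∃ i, n < N i) {P : ℕ → Prop}
    (hP : ∀ m, ∃ n, m ≤ n ∧ P n) (j : ℕ) :
    ∃ i, j ≤ i ∧ ∃ n, N i ≤ n ∧ n < N (i+1) ∧ P n := by
  classical
  obtain ⟨n, hn, hPn⟩ := hP (N j)
  have hex := hu n
  obtain ⟨k, hk⟩ : ∃ k, k = Nat.find hex := ⟨_, rfl⟩
  have h1 : n < N k := hk ▸ Nat.find_spec hex
  have hjk : j < k := by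
    by_contra hc
    have := hN (not_lt.1 hc)
    omega
  obtain ⟨i, rfl⟩ : ∃ i, k = i + 1 := ⟨k - 1, by omega⟩
  have h2 : ¬ n < N i := Nat.find_min hex (by omega)
  exact ⟨i, by omega, n, not_lt.1 h2, h1, hPn⟩

lemma exists_crossing (us : ℕ → List α) {M : ℕ} (hM : ∀ n, (us n).length ≤ M)
    (hu : ∀ k : ℕ, ∃ n, k ≤ (partialConcat us n).length)
    {B : ℕ → ℕ} (hB : StrictMono B) (hB0 : B 0 = 0) :
    ∃ N : ℕ → ℕ, Monotone N ∧ N 0 = 0 ∧ (∀ n, ∃ i, n < N i) ∧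
      (∀ i, B i ≤ (partialConcat us (N i)).length ∧ (partialConcat us (N i)).length ≤ B i + M) ∧
      ∀ i n, (partialConcat us n).length < B i → n < N i := by
  classical
  have key : ∀ i n, (partialConcat us n).length < B i → n < Nat.find (hu (B i)) := by
    intro i n h
    by_contra hc
    have h1 := Nat.find_spec (hu (B i))
    have h2 := pc_len_mono us (not_lt.1 hc)
    omega
  refine ⟨fun i => Nat.find (hu (B i)), ?_, ?_, ?_, ?_, key⟩
  · intro i j hij
    apply Nat.find_mono
    intro n hn
    exact (hB.monotone hij).trans hn
  · simp [hB0]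
  · intro n
    refine ⟨(partialConcat us n).length + 1, key _ _ ?_⟩
    exact Nat.lt_of_lt_of_le (Nat.lt_succ_self _) hB.le_apply
  · intro i
    have h1 := Nat.find_spec (hu (B i))
    refine ⟨h1, ?_⟩
    rcases Nat.eq_zero_or_pos (Nat.find (hu (B i))) with h0 | h0
    · show (partialConcat us (Nat.find (hu (B i)))).length ≤ _
      rw [h0, pc_zero]; simp
    · obtain ⟨m, hm⟩ : ∃ m, Nat.find (hu (B i)) = m + 1 := ⟨Nat.find (hu (B i)) - 1, by omega⟩
      have h2 := Nat.find_min (hu (B i)) (m := m) (by omega)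
      show (partialConcat us (Nat.find (hu (B i)))).length ≤ _
      rw [hm, pc_succ, List.length_append]
      have := hM m
      omega

/-- Glueing an infinite sequence of paths into a successful computation. -/
lemma build [Finite K] {Δ : Set (K × List α × List β × K)} {F : Set K} {M : ℕ}
    {y : ℕ → α} {B : ℕ → ℕ} (hB : StrictMono B) (hB0 : B 0 = 0)
    {cs : ℕ → Cfg α K M} {ls : ℕ → List (K × List α × List β × K)}
    (h0 : (cs 0).2.1 = [])
    (hp : ∀ i, IsPath Δ (cs i).1 (ls i) (cs (i+1)).1)
    (hin : ∀ i, (cs i).2.1 ++ inp (ls i) = seg y (B i) (B (i+1)) ++ (cs (i+1)).2.1)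
    (hf1 : ∀ m, ∃ i, m ≤ i ∧ (flag F (ls i)).1)
    (hf2 : ∀ m, ∃ i, m ≤ i ∧ (flag F (ls i)).2) :
    ∃ z, (y, z) ∈ twoTapeBuchiRel Δ (cs 0).1 F ∧ outp (ls 0) <+: seg z 0 (outp (ls 0)).length := by
  classical
  have hne : ∀ m, ∃ n, m ≤ n ∧ ls n ≠ [] := by
    intro m
    obtain ⟨i, hi, t, ht, -⟩ := hf1 m
    exact ⟨i, hi, List.ne_nil_of_mem ht⟩
  obtain ⟨t, ht⟩ := exists_infConcat ls (pc_unbounded ls hne)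
  rw [infConcatEq_iff] at ht
  obtain ⟨ht, htu⟩ := ht
  have hP : ∀ n, IsPath Δ (cs 0).1 (partialConcat ls n) (cs n).1 := by
    intro n
    induction n with
    | zero => rw [pc_zero]; rfl
    | succ n ih => rw [pc_succ]; exact ih.append (hp n)
  have hI : ∀ n, inp (partialConcat ls n) = seg y 0 (B n) ++ (cs n).2.1 := by
    intro n
    induction n with
    | zero => simp [pc_zero, inp, hB0, seg_self, h0]
    | succ n ih =>
      rw [pc_succ, inp_append, ih, List.append_assoc, hin, ← List.append_assoc,
        seg_append y (Nat.zero_le _) (hB.monotone (Nat.le_succ n))]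
  have hO : ∀ n, outp (partialConcat ls n) = partialConcat (fun i => outp (ls i)) n := by
    intro n
    induction n with
    | zero => simp [pc_zero, outp]
    | succ n ih => rw [pc_succ, pc_succ, outp_append, ih]
  -- the output word
  obtain ⟨z, hz⟩ := exists_infConcat (fun i => outp (ls i)) (pc_unbounded _ hf2)
  rw [infConcatEq_iff] at hz
  obtain ⟨hz, hzu⟩ := hz
  have htΔ : ∀ n, t n ∈ Δ := by
    intro n
    obtain ⟨N, hN⟩ := htu (n+1)
    apply (hP N).mem
    rw [ht N]
    exact mem_seg t (Nat.zero_le _) hN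
  have htc : ∀ n, (t n).2.2.2 = (t (n+1)).1 := by
    intro n
    obtain ⟨N, hN⟩ := htu (n+2)
    have h1 := hP N
    rw [ht N] at h1
    have h2 := h1.chain n (by rw [seg_length]; omega)
    rw [seg_getElem, seg_getElem] at h2
    simpa using h2
  have ht0 : (t 0).1 = (cs 0).1 := by
    obtain ⟨N, hN⟩ := htu 1
    have h1 := hP N
    rw [ht N] at h1
    have h2 := h1.start (by rw [seg_length]; omega)
    rw [seg_getElem] at h2
    simpa using h2
  have hpre : ∀ n, ∃ N, seg t 0 n <+: partialConcat ls N := by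
    intro n
    obtain ⟨N, hN⟩ := htu n
    refine ⟨N, ?_⟩
    rw [ht N]
    exact prefix_seg t hN
  have hinpre : ∀ l l' : List (K × List α × List β × K), l <+: l' → inp l <+: inp l' := by
    rintro l _ ⟨s, rfl⟩
    rw [inp_append]; exact List.prefix_append _ _
  have houtpre : ∀ l l' : List (K × List α × List β × K), l <+: l' → outp l <+: outp l' := by
    rintro l _ ⟨s, rfl⟩
    rw [outp_append]; exact List.prefix_append _ _
  refine ⟨z, ⟨fun n => (t n).1, fun n => (t n).2.1, fun n => (t n).2.2.1, ht0, ?_, ?_, ?_, ?_⟩, ?_⟩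
  · intro n
    show ((t n).1, (t n).2.1, (t n).2.2.1, (t (n+1)).1) ∈ Δ
    rw [← htc n]; exact htΔ n
  · -- accepting
    have hinf : {n | (t n).1 ∈ F}.Infinite := by
      rw [Set.infinite_iff_exists_gt]
      intro a
      obtain ⟨N, hN⟩ := htu (a+1)
      obtain ⟨i, hi, s, hs, hsF⟩ := hf1 N
      obtain ⟨j, hj, rfl⟩ := List.getElem_of_mem hs
      have hlen := pc_len_mono ls hi
      refine ⟨(partialConcat ls i).length + j, ?_, by omega⟩
      have h1 := ht (i+1)
      have h2 : (partialConcat ls i).length + j < (partialConcat ls (i+1)).length := by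
        rw [pc_succ, List.length_append]; omega
      have h3 : (partialConcat ls (i+1))[(partialConcat ls i).length + j]
          = t ((partialConcat ls i).length + j) := by
        rw [List.getElem_of_eq h1, seg_getElem, zero_add]
      have h4 : (partialConcat ls (i+1))[(partialConcat ls i).length + j] = (ls i)[j] := by
        rw [List.getElem_of_eq (pc_succ ls i), List.getElem_append_right (by omega)]
        simp
      show (t _).1 ∈ F
      rw [← h3, h4]; exact hsF
    by_contra hcon
    push Not at hcon
    apply hinf
    have : {n | (t n).1 ∈ F} ⊆ ⋃ q ∈ F, {n | (t n).1 = q} := by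
      intro n hn
      simp only [Set.mem_iUnion]
      exact ⟨(t n).1, hn, rfl⟩
    refine Set.Finite.subset (Set.Finite.biUnion (Set.toFinite F) ?_) this
    intro q hq
    simpa using hcon q hq
  · rw [infConcatEq_iff]
    refine ⟨fun n => ?_, fun k => ?_⟩
    · rw [← inp_seg_zero]
      obtain ⟨N, hN⟩ := hpre n
      have h1 := hinpre _ _ hN
      set l := inp (seg t 0 n) with hl
      have h2 : inp (partialConcat ls N) <+: inp (partialConcat ls (max N l.length)) :=
        hinpre _ _ (pc_prefix_mono ls (le_max_left _ _))
      have h3 := h1.trans h2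
      rw [hI] at h3
      have h4 : l.length ≤ B (max N l.length) := (le_max_right _ _).trans hB.le_apply
      have h5 : l <+: seg y 0 (B (max N l.length)) :=
        List.prefix_of_prefix_length_le h3 (List.prefix_append _ _)
          (by rw [seg_length]; omega)
      exact eq_seg_of_prefix_seg h5
    · refine ⟨(partialConcat ls k).length, ?_⟩
      rw [← inp_seg_zero, ← ht k, hI, List.length_append, seg_length]
      have : k ≤ B k := hB.le_apply
      omega
  · rw [infConcatEq_iff]
    refine ⟨fun n => ?_, fun k => ?_⟩
    · rw [← outp_seg_zero]
      obtain ⟨N, hN⟩ := hpre n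
      have h1 := houtpre _ _ hN
      rw [hO, hz] at h1
      exact eq_seg_of_prefix_seg h1
    · obtain ⟨N, hN⟩ := hzu k
      refine ⟨(partialConcat ls N).length, ?_⟩
      rw [← outp_seg_zero, ← ht N, hO]
      exact hN
  · have h1 := hz 1
    rw [show partialConcat (fun i => outp (ls i)) 1 = outp (ls 0) by simp [partialConcat]] at h1
    rw [← h1]

end Runs

section Pattern
variable {α : Type*}

def occ (P : List α) (x : ℕ → α) (n : ℕ) : Prop := seg x n (n + P.length) = P

lemma occ_iff (P : List α) (x : ℕ → α) (n : ℕ) :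
    occ P x n ↔ ∀ j (h : j < P.length), x (n + j) = P[j] := by
  unfold occ
  constructor
  · intro h j hj
    have := List.getElem_of_eq h (i := j) (by rw [seg_length]; omega)
    rw [← this, seg_getElem]
  · intro h
    apply List.ext_getElem
    · simp [seg_length]
    · intro i h1 h2
      rw [seg_getElem]; exact h i h2

/-- words containing `P` infinitely often -/
def GP (P : List α) : Set (ℕ → α) := {x | ∀ m, ∃ n, m ≤ n ∧ occ P x n}

def patδ (P : List α) (S : Set (Fin (P.length + 1))) (a : α) : Set (Fin (P.length + 1)) :=
  {j | j.1 = 0 ∨ ∃ i ∈ S, j.1 = i.1 + 1 ∧ ∃ h : i.1 < P.length, P[i.1] = a}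

lemma patrun (P : List α) (x : ℕ → α) (n : ℕ) (i : Fin (P.length + 1)) :
    i ∈ detRun (patδ P) {j | j.1 = 0} x n ↔
      ∃ m, m + i.1 = n ∧ ∀ j (h : j < P.length), j < i.1 → x (m + j) = P[j] := by
  induction n generalizing i with
  | zero =>
    show i.1 = 0 ↔ _
    constructor
    · intro h
      exact ⟨0, by omega, by intro j _ hj; omega⟩
    · rintro ⟨m, hm, -⟩; omega
  | succ n ih =>
    show (i.1 = 0 ∨ ∃ k ∈ detRun (patδ P) {j | j.1 = 0} x n, i.1 = k.1 + 1 ∧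
      ∃ h : k.1 < P.length, P[k.1] = x n) ↔ _
    constructor
    · rintro (h | ⟨k, hk, hik, hkP, hx⟩)
      · exact ⟨n+1, by omega, by intro j _ hj; omega⟩
      · obtain ⟨m, hm, hall⟩ := (ih k).1 hk
        refine ⟨m, by omega, fun j hj hji => ?_⟩
        rcases Nat.lt_or_ge j k.1 with h | h
        · exact hall j hj h
        · have : j = k.1 := by omega
          subst this
          rw [hm, hx]
    · rintro ⟨m, hm, hall⟩
      rcases Nat.eq_zero_or_pos i.1 with h | h
      · exact Or.inl h
      · right
        have hi := i.2
        refine ⟨⟨i.1 - 1, by omega⟩, ?_, by simp; omega, by simp; omega, ?_⟩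
        · rw [ih]
          exact ⟨m, by simp; omega, fun j hj hji => hall j hj (by simp at hji; omega)⟩
        · have := hall (i.1 - 1) (by omega) (by omega)
          rw [← this]
          congr 1; omega

lemma GP_dba (P : List α) :
    GP P = dbaLang (patδ P) {j | j.1 = 0} {S | Fin.last P.length ∈ S} := by
  ext x
  show _ ↔ {n | Fin.last P.length ∈ detRun (patδ P) {j | j.1 = 0} x n}.Infinite
  rw [Set.infinite_iff_exists_gt]
  constructor
  · intro h a
    obtain ⟨n, hn, ho⟩ := h (a+1)
    refine ⟨n + P.length, ?_, by omega⟩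
    show Fin.last P.length ∈ detRun (patδ P) {j | j.1 = 0} x _
    rw [patrun]
    exact ⟨n, by simp, fun j hj _ => (occ_iff P x n).1 ho j hj⟩
  · intro h m
    obtain ⟨n, hn, hlt⟩ := h (m + P.length)
    obtain ⟨k, hk, hall⟩ := (patrun P x n _).1 hn
    simp only [Fin.val_last] at hk hall
    exact ⟨k, by omega, (occ_iff P x k).2 fun j hj => hall j hj hj⟩

lemma agree_mem_nhds [TopologicalSpace α] [DiscreteTopology α] (x : ℕ → α) (m : ℕ) :
    {y : ℕ → α | ∀ i, i < m → y i = x i} ∈ nhds x := by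
  have : {y : ℕ → α | ∀ i, i < m → y i = x i} = ⋂ i ∈ Finset.range m, {y | y i = x i} := by
    ext y; simp
  rw [this, Filter.biInter_finset_mem]
  intro i _
  have h : {x i} ∈ nhds (x i) := IsOpen.mem_nhds (isOpen_discrete {x i}) rfl
  exact (continuous_apply i).continuousAt.preimage_mem_nhds h

lemma exists_agree_subset [TopologicalSpace α] [DiscreteTopology α] {x : ℕ → α}
    {U : Set (ℕ → α)} (hU : IsOpen U) (hx : x ∈ U) :
    ∃ m, ∀ y, (∀ i, i < m → y i = x i) → y ∈ U := by
  obtain ⟨I, u, hu, hsub⟩ := isOpen_pi_iff.1 hU x hx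
  refine ⟨I.sup id + 1, fun y hy => hsub fun i hi => ?_⟩
  have : i ≤ I.sup id := Finset.le_sup (f := id) hi
  rw [hy i (by omega)]
  exact (hu i hi).2

lemma GP_gdelta [Finite α] [Nonempty α] [TopologicalSpace α] [DiscreteTopology α] (P : List α) :
    IsGδ (GP P) ∧ Dense (GP P) := by
  have e : GP P = ⋂ m, {x | ∃ n, m ≤ n ∧ occ P x n} := by
    ext x; simp [GP]
  have ho : ∀ m, IsOpen {x | ∃ n, m ≤ n ∧ occ P x n} := by
    intro m
    rw [isOpen_iff_mem_nhds]
    rintro x ⟨n, hn, h⟩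
    filter_upwards [agree_mem_nhds x (n + P.length)] with y hy
    refine ⟨n, hn, ?_⟩
    unfold occ
    rw [seg_congr hy]; exact h
  have hd : ∀ m, Dense {x | ∃ n, m ≤ n ∧ occ P x n} := by
    intro m
    rw [dense_iff_inter_open]
    rintro U hU ⟨x, hx⟩
    obtain ⟨k, hk⟩ := exists_agree_subset hU hx
    let y : ℕ → α := fun i => if i < max k m then x i else P.getD (i - max k m) (x 0)
    refine ⟨y, hk y ?_, max k m, le_max_right _ _, ?_⟩
    · intro i hi
      simp only [y]
      rw [if_pos (lt_of_lt_of_le hi (le_max_left _ _))]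
    · rw [occ_iff]
      intro j hj
      simp only [y]
      rw [if_neg (by omega), Nat.add_sub_cancel_left, List.getD_eq_getElem _ _ hj]
  have : Finite α := inferInstance
  rw [e]
  exact ⟨IsGδ.iInter_of_isOpen ho, dense_iInter_of_isOpen_nat ho hd⟩

end Pattern

section Generic
variable {α : Type*}

def IsB (w : List α) (x : ℕ → α) (b : ℕ) : Prop :=
  occ w x b ∧ ∃ m, m + w.length = b ∧ seg x m b = w

lemma isB_of_occ {w : List α} {x : ℕ → α} {n : ℕ} (h : occ (w ++ w) x n) :
    IsB w x (n + w.length) := by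
  unfold occ at h
  rw [List.length_append, ← seg_append x (b := n + w.length) (by omega) (by omega)] at h
  obtain ⟨h1, h2⟩ := List.append_inj h (by rw [seg_length]; omega)
  exact ⟨by unfold occ; rw [add_assoc]; exact h2, n, rfl, h1⟩

lemma IsB.congr {w : List α} {x y : ℕ → α} {b : ℕ} (h : IsB w x b)
    (hxy : ∀ i, i < b + w.length → y i = x i) : IsB w y b := by
  obtain ⟨h1, m, hm, h2⟩ := h
  refine ⟨?_, m, hm, ?_⟩
  · unfold occ at *
    rw [seg_congr hxy]; exact h1
  · rw [seg_congr (fun i hi => hxy i (by omega))]; exact h2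

lemma exists_fact {Q : Type*} [Monoid Q] [Finite Q] {φ : List α → Q}
    (hφ : ∀ u v, φ (u ++ v) = φ u * φ v) {w : List α} {e : Q} (hw : φ w = e) (he : e * e = e)
    (hmin : ∀ a, e * a = a → a * e = a → ∃ k, 1 ≤ k ∧ a ^ k = e)
    {x : ℕ → α} (hx : x ∈ GP (w ++ w)) {b0 : ℕ} (hb0 : IsB w x b0) :
    ∃ (p : Q) (g : ℕ → ℕ), StrictMono g ∧ b0 < g 0 ∧ e * p = p ∧ p * e = p ∧
      φ (seg x b0 (g 0)) = p ∧ ∀ i, φ (seg x (g i) (g (i+1))) = e := by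
  have hleft : ∀ b b', IsB w x b → b + w.length ≤ b' →
      e * φ (seg x b b') = φ (seg x b b') := by
    rintro b b' ⟨h, -⟩ hle
    rw [← seg_append x (Nat.le_add_right b w.length) hle, h, hφ, hw, ← mul_assoc, he]
  have hright : ∀ b b', IsB w x b' → b + w.length ≤ b' →
      φ (seg x b b') * e = φ (seg x b b') := by
    rintro b b' ⟨-, m, hm, h⟩ hle
    rw [← seg_append x (b := m) (by omega) (by omega), h, hφ, hw, mul_assoc, he]
  let T : Set ℕ := {b | IsB w x b ∧ b0 + w.length + 1 ≤ b}
  have hT : T.Infinite := by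
    rw [Set.infinite_iff_exists_gt]
    intro a
    obtain ⟨n, hn, h⟩ := hx (a + b0 + w.length + 1)
    exact ⟨n + w.length, ⟨isB_of_occ h, by omega⟩, by omega⟩
  obtain ⟨p, hp⟩ : ∃ p, {b | b ∈ T ∧ φ (seg x b0 b) = p}.Infinite := by
    by_contra hcon
    push Not at hcon
    apply hT
    refine (Set.finite_iUnion hcon).subset ?_
    intro b hb
    simp only [Set.mem_iUnion]
    exact ⟨_, hb, rfl⟩
  let g : ℕ → ℕ := fun i => Nat.nth (fun b => b ∈ T ∧ φ (seg x b0 b) = p) ((w.length + 1) * i)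
  have hg : ∀ i, g i ∈ T ∧ φ (seg x b0 (g i)) = p := fun i => Nat.nth_mem_of_infinite hp _
  have hgap : ∀ i, g i + (w.length + 1) ≤ g (i+1) := by
    intro i
    have := (Nat.nth_strictMono hp).add_le_nat (w.length + 1) ((w.length + 1) * i)
    simp only [g]
    rw [Nat.mul_succ, add_comm ((w.length + 1) * i) (w.length + 1)]
    omega
  have hep : e * p = p := by
    rw [← (hg 0).2]
    exact hleft _ _ hb0 (by have := (hg 0).1.2; omega)
  have hpe : p * e = p := by
    rw [← (hg 0).2]
    exact hright _ _ (hg 0).1.1 (by have := (hg 0).1.2; omega)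
  refine ⟨p, g, strictMono_nat_of_lt_succ fun i => ?_, ?_, hep, hpe, (hg 0).2, fun i => ?_⟩
  · have := hgap i; omega
  · have := (hg 0).1.2; omega
  · apply cancel_left hmin hep hpe
    · exact hleft _ _ (hg i).1.1 (by have := hgap i; omega)
    · nth_rewrite 1 [← (hg i).2]
      rw [← hφ, seg_append x (by have := (hg i).1.2; omega) (by have := hgap i; omega)]
      exact (hg (i+1)).2

def posSeq (b0 : ℕ) (g : ℕ → ℕ) : ℕ → ℕ
  | 0 => 0
  | 1 => b0
  | i + 2 => g i

lemma posSeq_strictMono {b0 : ℕ} {g : ℕ → ℕ} (h0 : 0 < b0) (h1 : b0 < g 0) (hg : StrictMono g) :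
    StrictMono (posSeq b0 g) := by
  apply strictMono_nat_of_lt_succ
  intro i
  match i with
  | 0 => exact h0
  | 1 => exact h1
  | i + 2 => exact hg (Nat.lt_succ_self i)

end Generic

section Core
variable {α β K : Type*}

lemma core [Finite K] {Δ : Set (K × List α × List β × K)} {F : Set K} {M : ℕ}
    (hM : ∀ t ∈ Δ, t.2.1.length ≤ M) {q₀ : K} {x : ℕ → α} {z : ℕ → β}
    (hxz : (x, z) ∈ twoTapeBuchiRel Δ q₀ F) (n : ℕ) :
    ∃ k, ∀ (y : ℕ → α) (b0 : ℕ), k < b0 → (∀ i, i < b0 → y i = x i) → ∀ (g g' : ℕ → ℕ),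
      StrictMono g → StrictMono g' → b0 < g 0 → b0 < g' 0 → ∀ C D : List α,
      prof Δ F M (seg x b0 (g 0) ++ C) = prof Δ F M (seg y b0 (g' 0)) →
      (∀ i, prof Δ F M (seg x (g i) (g (i+1))) = prof Δ F M (C ++ D)) →
      (∀ i, prof Δ F M (seg y (g' i) (g' (i+1))) = prof Δ F M (D ++ C)) →
      ∃ z', (y, z') ∈ twoTapeBuchiRel Δ q₀ F ∧ z' n = z n := by
  obtain ⟨qs, us, vs, hq0, hstep, ⟨qf, hqf, hinf⟩, hx, hz⟩ := hxz
  simp only at hx hz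
  obtain ⟨n0, hn0⟩ := hz.2 (n+1)
  refine ⟨(partialConcat us n0).length, ?_⟩
  intro y b0 hb0 hxy g g' hg hg' hbg hbg' C D hC hE hE'
  let t : ℕ → K × List α × List β × K := fun n => (qs n, us n, vs n, qs (n+1))
  have hxi := (infConcatEq_iff _ _).1 hx
  have hzi := (infConcatEq_iff _ _).1 hz
  let B := posSeq b0 g
  let B' := posSeq b0 g'
  have hB : StrictMono B := posSeq_strictMono (by omega) hbg hg
  have hB' : StrictMono B' := posSeq_strictMono (by omega) hbg' hg'
  obtain ⟨N, hNm, hN0, hNu, hNB, hNl⟩ :=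
    exists_crossing us (fun n => hM _ (hstep n)) hxi.2 hB rfl
  let cs : ℕ → Cfg α K M := fun i => (qs (N i), ⟨seg x (B i) (partialConcat us (N i)).length, by
    rw [seg_length]; have := hNB i; omega⟩)
  let l : ℕ → List (K × List α × List β × K) := fun i => seg t (N i) (N (i+1))
  have hl : ∀ i, IsPath Δ (cs i).1 (l i) (cs (i+1)).1 := fun i =>
    isPath_seg (t := t) hstep (fun _ => rfl) (hNm (Nat.le_succ i))
  have hin : ∀ i, (cs i).2.1 ++ inp (l i) = seg x (B i) (B (i+1)) ++ (cs (i+1)).2.1 := by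
    intro i
    have h1 : inp (l i) = seg x (partialConcat us (N i)).length
        (partialConcat us (N (i+1))).length := inp_seg (t := t) hx (hNm (Nat.le_succ i))
    have h2 := pc_len_mono us (hNm (Nat.le_succ i))
    show seg x (B i) (partialConcat us (N i)).length ++ inp (l i) =
      seg x (B i) (B (i+1)) ++ seg x (B (i+1)) (partialConcat us (N (i+1))).length
    rw [h1, seg_append x (hNB i).1 h2, seg_append x (hB.monotone (Nat.le_succ i)) (hNB (i+1)).1]
  have hmem : ∀ i, (cs i, flag F (l i), cs (i+1)) ∈ prof Δ F M (seg x (B i) (B (i+1))) :=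
    fun i => ⟨l i, hl i, hin i, rfl⟩
  have hf1 : ∀ m, ∃ i, m ≤ i ∧ (flag F (l i)).1 := by
    intro m
    obtain ⟨i, hi, k, hk1, hk2, hk⟩ := exists_block hNm hNu (P := fun n => qs n = qf) (by
      intro m
      obtain ⟨n, hn, hlt⟩ := Set.infinite_iff_exists_gt.1 hinf m
      exact ⟨n, hlt.le, hn⟩) m
    refine ⟨i, hi, t k, mem_seg t hk1 hk2, ?_⟩
    show qs k ∈ F
    rw [hk]; exact hqf
  have hf2 : ∀ m, ∃ i, m ≤ i ∧ (flag F (l i)).2 := by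
    intro m
    obtain ⟨i, hi, k, hk1, hk2, hk⟩ := exists_block hNm hNu (P := fun n => vs n ≠ [])
      (nonempty_of_unbounded vs hzi.2) m
    refine ⟨i, hi, ?_⟩
    show outp (l i) ≠ []
    intro h0
    apply hk
    have := mem_seg t hk1 hk2
    unfold outp at h0
    rw [List.flatten_eq_nil_iff] at h0
    exact h0 _ (List.mem_map_of_mem this)
  -- split the later blocks
  have hsplit : ∀ j, ∃ d fa fb, (cs (j+2), fa, d) ∈ prof Δ F M C ∧
      (d, fb, cs (j+3)) ∈ prof Δ F M D ∧ flag F (l (j+2)) = fa ⊔ fb := by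
    intro j
    have h1 := hmem (j+2)
    have h2 : prof Δ F M (seg x (B (j+2)) (B (j+2+1))) = prof Δ F M (C ++ D) := hE j
    rw [h2, prof_append F hM] at h1
    obtain ⟨d, fa, fb, ha, hb, hab⟩ := h1
    exact ⟨d, fa, fb, ha, hb, hab⟩
  choose dd fa fb hfa hfb hfab using hsplit
  let cs' : ℕ → Cfg α K M := fun i => match i with
    | 0 => cs 0
    | 1 => cs 1
    | j + 2 => dd j
  have hls : ∀ i, ∃ l', IsPath Δ (cs' i).1 l' (cs' (i+1)).1 ∧
      (cs' i).2.1 ++ inp l' = seg y (B' i) (B' (i+1)) ++ (cs' (i+1)).2.1 ∧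
      (i = 0 → l' = l 0) ∧ ∀ j, i = j + 2 → flag F l' = fb j ⊔ fa (j+1) := by
    intro i
    match i with
    | 0 =>
      refine ⟨l 0, hl 0, ?_, fun _ => rfl, fun j hj => by omega⟩
      have h1 := hin 0
      have h2 : seg y (B' 0) (B' (0+1)) = seg x (B 0) (B (0+1)) := seg_congr hxy
      rw [h2]; exact h1
    | 1 =>
      have h1 : (cs 1, flag F (l 1) ⊔ fa 0, dd 0) ∈ prof Δ F M (seg y b0 (g' 0)) := by
        rw [← hC, prof_append F hM]
        exact ⟨cs 2, flag F (l 1), fa 0, hmem 1, hfa 0, rfl⟩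
      obtain ⟨l', h1, h2, h3⟩ := h1
      exact ⟨l', h1, h2, fun h => by omega, fun j hj => by omega⟩
    | j + 2 =>
      have h1 : (dd j, fb j ⊔ fa (j+1), dd (j+1)) ∈ prof Δ F M (seg y (g' j) (g' (j+1))) := by
        rw [hE', prof_append F hM]
        exact ⟨cs (j+3), fb j, fa (j+1), hfb j, hfa (j+1), rfl⟩
      obtain ⟨l', h1, h2, h3⟩ := h1
      refine ⟨l', h1, h2, fun h => by omega, fun k hk => ?_⟩
      obtain rfl : j = k := by omega
      exact h3
  choose ls hls1 hls2 hls3 hls4 using hls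
  obtain ⟨z', hz', hpre⟩ := build (F := F) hB' rfl (cs := cs') (ls := ls)
    (by
      show seg x (B 0) (partialConcat us (N 0)).length = []
      rw [hN0, pc_zero]; exact seg_self x 0)
    hls1 hls2
    (by
      intro m
      obtain ⟨i, hi, h⟩ := hf1 (m+3)
      obtain ⟨j, rfl⟩ : ∃ j, i = j + 3 := ⟨i - 3, by omega⟩
      rw [hfab (j+1)] at h
      rcases h with h | h
      · exact ⟨j+2, by omega, by rw [hls4 (j+2) j rfl]; exact Or.inr h⟩
      · exact ⟨j+1+2, by omega, by rw [hls4 (j+1+2) (j+1) rfl]; exact Or.inl h⟩)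
    (by
      intro m
      obtain ⟨i, hi, h⟩ := hf2 (m+3)
      obtain ⟨j, rfl⟩ : ∃ j, i = j + 3 := ⟨i - 3, by omega⟩
      rw [hfab (j+1)] at h
      rcases h with h | h
      · exact ⟨j+2, by omega, by rw [hls4 (j+2) j rfl]; exact Or.inr h⟩
      · exact ⟨j+1+2, by omega, by rw [hls4 (j+1+2) (j+1) rfl]; exact Or.inl h⟩)
  have hq : (cs' 0).1 = q₀ := by
    show qs (N 0) = q₀
    rw [hN0, hq0]
  rw [hq] at hz'
  refine ⟨z', hz', ?_⟩
  have ho : outp (ls 0) = partialConcat vs (N 1) := by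
    rw [hls3 0 rfl]
    show outp (seg t (N 0) (N 1)) = _
    rw [hN0, outp_seg_zero]
  rw [ho] at hpre
  have hN1 : n0 < N 1 := hNl 1 n0 hb0
  have hlen : n < (partialConcat vs (N 1)).length := by
    have := pc_len_mono vs hN1.le
    omega
  have h1 := hpre.getElem hlen
  rw [List.getElem_of_eq (hzi.1 (N 1)), seg_getElem, seg_getElem] at h1
  simpa using h1.symm

end Core

/-- Let `f : α^ω → β^ω` be a total ω-rational function, i.e. its graph is
the infinitary rational relation accepted by some 2-tape Büchi automaton (with finite
state set and finite transition set). Then there is a dense `Π⁰₂` (Gδ) subset `G` of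
`α^ω`, accepted by a deterministic Büchi automaton with finite state set, such that the
restriction of `f` to `G` is continuous. -/
theorem omega_rational_continuous_on_dense_regular_Gdelta
    {α : Type*} [Fintype α] [Nonempty α] [TopologicalSpace α] [DiscreteTopology α]
    {β : Type*} [Fintype β] [Nonempty β] [TopologicalSpace β] [DiscreteTopology β]
    (f : (ℕ → α) → (ℕ → β))
    {K : Type*} [Fintype K] (Δ : Set (K × List α × List β × K)) (hΔ : Δ.Finite)
    (q₀ : K) (F : Set K)
    (hgraph : {p : (ℕ → α) × (ℕ → β) | p.2 = f p.1} = twoTapeBuchiRel Δ q₀ F) :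
    ∃ G : Set (ℕ → α),
      IsGδ G ∧ Dense G ∧ ContinuousOn f G ∧
      ∃ (K' : Type) (_ : Fintype K') (δ : K' → α → K') (q₀' : K') (F' : Set K'),
        G = dbaLang δ q₀' F' := by
  classical
  obtain ⟨M, hM⟩ : ∃ M, ∀ t ∈ Δ, t.2.1.length ≤ M := by
    obtain ⟨M, hM⟩ := (hΔ.image (fun t => t.2.1.length)).bddAbove
    exact ⟨M, fun t ht => hM ⟨t, ht, rfl⟩⟩
  have hfin := profCon_finite Δ F hM
  obtain ⟨e, he, hmin⟩ := exists_min_idem (profCon Δ F hM).Quotient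
  let φ : List α → (profCon Δ F hM).Quotient := fun l => (profCon Δ F hM).mk' (FreeMonoid.ofList l)
  have hφ : ∀ u v, φ (u ++ v) = φ u * φ v := by
    intro u v
    simp only [φ]
    rw [FreeMonoid.ofList_append, map_mul]
  have hsurj : ∀ s, ∃ l, φ l = s := by
    intro s
    obtain ⟨u, hu⟩ := Con.mk'_surjective (c := profCon Δ F hM) s
    exact ⟨u.toList, hu⟩
  have hprof : ∀ u v, φ u = φ v → prof Δ F M u = prof Δ F M v := fun u v h => (Con.eq _).1 h
  obtain ⟨w, hw⟩ := hsurj e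
  refine ⟨GP (w ++ w), (GP_gdelta _).1, (GP_gdelta _).2, ?_,
    Set (Fin ((w ++ w).length + 1)), inferInstance, patδ (w ++ w), {j | j.1 = 0},
    {S | Fin.last (w ++ w).length ∈ S}, GP_dba _⟩
  intro x hx
  rw [ContinuousWithinAt, tendsto_pi_nhds]
  intro n
  have hR : ∀ x z, (x, z) ∈ twoTapeBuchiRel Δ q₀ F ↔ z = f x := by
    intro x z
    rw [← hgraph]; rfl
  refine Filter.Tendsto.congr' ?_ tendsto_const_nhds
  -- a boundary of `x`
  obtain ⟨k, hk⟩ := core hM ((hR x (f x)).2 rfl) n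
  obtain ⟨n1, hn1, hocc⟩ := hx (k + 1)
  have hb0 := isB_of_occ hocc
  set b0 := n1 + w.length with hb0def
  obtain ⟨p, g, hg, hbg, hep, hpe, hp, hE⟩ := exists_fact hφ hw he hmin hx hb0
  have hev : ∀ᶠ y in nhdsWithin x (GP (w ++ w)), ∀ i, i < b0 + w.length → y i = x i :=
    mem_nhdsWithin_of_mem_nhds (agree_mem_nhds x (b0 + w.length))
  filter_upwards [hev, self_mem_nhdsWithin] with y hy hyG
  obtain ⟨p', g', hg', hbg', hep', hpe', hp', hE'⟩ :=
    exists_fact hφ hw he hmin hyG (hb0.congr hy)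
  obtain ⟨c, d, hc, hcd, hdc⟩ := link hmin hep hpe hep' hpe'
  obtain ⟨C, rfl⟩ := hsurj c
  obtain ⟨D, rfl⟩ := hsurj d
  obtain ⟨z', hz', hzn⟩ := hk y b0 (by omega) (fun i hi => hy i (by omega)) g g' hg hg' hbg hbg' C D
    (hprof _ _ (by rw [hφ, hp, hp', hc]))
    (fun i => hprof _ _ (by rw [hφ, hE, hcd]))
    (fun i => hprof _ _ (by rw [hφ, hE', hdc]))
  rw [(hR y z').1 hz'] at hzn
  exact hzn.symm
end
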